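/- arXiv:2306.00524 — 3 statements merged into one kernel-verified Lean document; each statement's English description precedes it below -/
import Mathlib

section
/- Every cw-expansive homeomorphism f of a Peano continuum X admits a self-similar hyperbolic cw-metric: there exist a hyperbolic cw-metric D:E→ℝ for f and constants ξ>0 and λ>1 such that whenever D(C_(p,q))≤ξ one has max{D(f(C_(p,q))), D(f⁻¹(C_(p,q)))} = λ·D(C_(p,q)). -/
open Metric Set Filter Topology

namespace CwDyn

variable {X : Type*} [MetricSpace X]

/-- The ε-stable set of `x`. -/
def Ws (f : X ≃ₜ X) (ε : ℝ) (x : X) : Set X :=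
  {y | ∀ n : ℕ, dist ((⇑f)^[n] x) ((⇑f)^[n] y) ≤ ε}

/-- The ε-unstable set of `x`. -/
def Wu (f : X ≃ₜ X) (ε : ℝ) (x : X) : Set X :=
  {y | ∀ n : ℕ, dist ((⇑f.symm)^[n] x) ((⇑f.symm)^[n] y) ≤ ε}

/-- The connected component of `x` in its ε-stable set. -/
def Cs (f : X ≃ₜ X) (ε : ℝ) (x : X) : Set X := connectedComponentIn (Ws f ε x) x

/-- The connected component of `x` in its ε-unstable set. -/
def Cu (f : X ≃ₜ X) (ε : ℝ) (x : X) : Set X := connectedComponentIn (Wu f ε x) x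

/-- `c` is a cw-expansive constant for `f`. -/
def CwExpansiveConst (f : X ≃ₜ X) (c : ℝ) : Prop :=
  0 < c ∧ ∀ x : X, IsTotallyDisconnected (Ws f c x ∩ Wu f c x)

/-- The cw-local-product-structure. -/
def CwLocalProduct (f : X ≃ₜ X) : Prop :=
  ∀ ε : ℝ, 0 < ε → ∃ δ : ℝ, 0 < δ ∧
    ∀ x y : X, dist x y < δ → (Cs f ε x ∩ Cu f ε y).Nonempty

/-- `f` is cw-hyperbolic: cw-expansive with the cw-local-product-structure. -/
def CwHyperbolic (f : X ≃ₜ X) : Prop :=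
  (∃ c : ℝ, CwExpansiveConst f c) ∧ CwLocalProduct f

/-- A subcontinuum: a nonempty compact connected subset. -/
def Subcontinuum (C : Set X) : Prop := IsCompact C ∧ IsConnected C

/-- `D` is a hyperbolic cw-metric for `f`, viewed as a function of triples `(p, q, C)`
with `C` a subcontinuum and `p, q ∈ C`. -/
structure IsHypCwMetric (f : X ≃ₜ X) (D : X → X → Set X → ℝ) : Prop where
  nonneg : ∀ (C : Set X) (p q : X), Subcontinuum C → p ∈ C → q ∈ C → 0 ≤ D p q C
  eq_zero_iff : ∀ (C : Set X) (p q : X), Subcontinuum C → p ∈ C → q ∈ C →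
    (D p q C = 0 ↔ ∃ z : X, C = {z})
  symm : ∀ (C : Set X) (p q : X), Subcontinuum C → p ∈ C → q ∈ C → D p q C = D q p C
  triangle : ∀ (A B : Set X) (a b c : X), Subcontinuum A → Subcontinuum B →
    a ∈ A → b ∈ A → b ∈ B → c ∈ B → D a c (A ∪ B) ≤ D a b A + D b c B
  hyperbolic : ∃ lam : ℝ, lam ∈ Set.Ioo (0 : ℝ) 1 ∧ ∃ ε₀ : ℝ, 0 < ε₀ ∧
    (∀ (C : Set X) (p q : X), Subcontinuum C → p ∈ C → q ∈ C →
      (∀ n : ℕ, diam ((⇑f)^[n] '' C) ≤ ε₀) →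
      ∀ n : ℕ, D ((⇑f)^[n] p) ((⇑f)^[n] q) ((⇑f)^[n] '' C) ≤ 4 * lam ^ n * D p q C) ∧
    (∀ (C : Set X) (p q : X), Subcontinuum C → p ∈ C → q ∈ C →
      (∀ n : ℕ, diam ((⇑f.symm)^[n] '' C) ≤ ε₀) →
      ∀ n : ℕ, D ((⇑f.symm)^[n] p) ((⇑f.symm)^[n] q) ((⇑f.symm)^[n] '' C) ≤
        4 * lam ^ n * D p q C)
  compat : ∀ δ : ℝ, 0 < δ → ∃ γ : ℝ, 0 < γ ∧
    (∀ (C : Set X) (p q : X), Subcontinuum C → p ∈ C → q ∈ C → diam C < γ → D p q C < δ) ∧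
    (∀ (C : Set X) (p q : X), Subcontinuum C → p ∈ C → q ∈ C → D p q C < γ → diam C < δ)

/-- A hyperbolic cw-metric `D` is self-similar with constants `ξ` and `lam`. -/
def SelfSimilarWith (f : X ≃ₜ X) (D : X → X → Set X → ℝ) (ξ lam : ℝ) : Prop :=
  ∀ (C : Set X) (p q : X), Subcontinuum C → p ∈ C → q ∈ C → D p q C ≤ ξ →
    max (D (f p) (f q) (⇑f '' C)) (D (f.symm p) (f.symm q) (⇑f.symm '' C)) = lam * D p q C

/-- `f` has continuous joint stable/unstable holonomies with respect to `D`
(for the fixed constants `ε` and `δ`); the membership `pstar ∈ Cu f ε p ∩ Cs f ε y`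
says exactly that `pstar ∈ π^s_{x,y}(p)`. -/
def ContJointHolonomies (f : X ≃ₜ X) (D : X → X → Set X → ℝ) (ε δ : ℝ) : Prop :=
  ∀ η : ℝ, 0 < η → ∃ γ : ℝ, 0 < γ ∧
    ∀ (x y p q pstar : X) (C C' : Set X),
      dist x y < δ →
      Subcontinuum C → C ⊆ Cs f ε x → p ∈ C → q ∈ C → D p q C ≤ γ →
      pstar ∈ Cu f ε p ∩ Cs f ε y →
      Subcontinuum C' → C' ⊆ Cu f ε p → p ∈ C' → pstar ∈ C' → D p pstar C' ≤ γ →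
      ∃ (Cst Cuu : Set X) (qstar : X),
        Subcontinuum Cst ∧ Cst ⊆ Cs f ε y ∧ pstar ∈ Cst ∧
        Subcontinuum Cuu ∧ Cuu ⊆ Cu f ε q ∧ q ∈ Cuu ∧
        qstar ∈ Cst ∩ Cuu ∧
        D pstar qstar Cst ≤ η ∧ D q qstar Cuu ≤ η

/-- `f` has pseudo-isometric joint stable/unstable holonomies with respect to `D`. -/
def PseudoIsomJointHolonomies (f : X ≃ₜ X) (D : X → X → Set X → ℝ) (ε δ : ℝ) : Prop :=
  ∀ η : ℝ, 0 < η → ∃ γ : ℝ, 0 < γ ∧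
    ∀ (x y p q pstar : X) (C C' : Set X),
      dist x y < δ →
      Subcontinuum C → C ⊆ Cs f ε x → p ∈ C → q ∈ C → D p q C ≤ γ →
      pstar ∈ Cu f ε p ∩ Cs f ε y →
      Subcontinuum C' → C' ⊆ Cu f ε p → p ∈ C' → pstar ∈ C' → D p pstar C' ≤ γ →
      ∃ (Cst Cuu : Set X) (qstar : X),
        Subcontinuum Cst ∧ Cst ⊆ Cs f ε y ∧ pstar ∈ Cst ∧
        Subcontinuum Cuu ∧ Cuu ⊆ Cu f ε q ∧ q ∈ Cuu ∧
        qstar ∈ Cst ∩ Cuu ∧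
        |D pstar qstar Cst / D p q C - 1| ≤ η ∧ |D q qstar Cuu / D p pstar C' - 1| ≤ η

/-- All local stable holonomies of `f` are isometric with respect to `D`. -/
def IsomStableHolonomies (f : X ≃ₜ X) (D : X → X → Set X → ℝ) (ε δ : ℝ) : Prop :=
  ∀ x y : X, dist x y < δ →
    ∀ (C : Set X) (p q : X), Subcontinuum C → C ⊆ Cs f δ x → p ∈ C → q ∈ C →
      ∃ (Cst : Set X) (pstar qstar : X),
        Subcontinuum Cst ∧ Cst ⊆ Cs f ε y ∧
        pstar ∈ Cu f ε p ∩ Cs f ε y ∧ pstar ∈ Cst ∧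
        qstar ∈ Cu f ε q ∩ Cs f ε y ∧ qstar ∈ Cst ∧
        D pstar qstar Cst = D p q C

/-- All local unstable holonomies of `f` are isometric with respect to `D`. -/
def IsomUnstableHolonomies (f : X ≃ₜ X) (D : X → X → Set X → ℝ) (ε δ : ℝ) : Prop :=
  ∀ x y : X, dist x y < δ →
    ∀ (C : Set X) (p q : X), Subcontinuum C → C ⊆ Cu f δ x → p ∈ C → q ∈ C →
      ∃ (Cst : Set X) (pstar qstar : X),
        Subcontinuum Cst ∧ Cst ⊆ Cu f ε y ∧
        pstar ∈ Cs f ε p ∩ Cu f ε y ∧ pstar ∈ Cst ∧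
        qstar ∈ Cs f ε q ∩ Cu f ε y ∧ qstar ∈ Cst ∧
        D pstar qstar Cst = D p q C

/-- The set of periodic points of `g`. -/
def Per (g : X → X) : Set X := {x | ∃ k : ℕ, 1 ≤ k ∧ g^[k] x = x}

/-- The set of non-wandering points of `g`. -/
def Omega (g : X → X) : Set X :=
  {x | ∀ U ∈ 𝓝 x, ∃ k : ℕ, 1 ≤ k ∧ (g^[k] '' U ∩ U).Nonempty}

/-- Topological transitivity. -/
def TopTransitive (g : X → X) : Prop :=
  ∀ U V : Set X, IsOpen U → IsOpen V → U.Nonempty → V.Nonempty →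
    ∃ n : ℕ, (g^[n] '' U ∩ V).Nonempty

/-- There is a finite ε-pseudo-orbit from `x` to `y` (of length at least one). -/
def PseudoOrbit (g : X → X) (ε : ℝ) (x y : X) : Prop :=
  ∃ (m : ℕ) (σ : ℕ → X), 1 ≤ m ∧ σ 0 = x ∧ σ m = y ∧
    ∀ k < m, dist (g (σ k)) (σ (k + 1)) ≤ ε

/-- `x` is a chain recurrent point of `g`. -/
def ChainRecurrent (g : X → X) (x : X) : Prop := ∀ ε : ℝ, 0 < ε → PseudoOrbit g ε x x

/-- The chain-recurrent class of `x`. -/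
def ChainClass (g : X → X) (x : X) : Set X :=
  {y | ChainRecurrent g y ∧ ∀ ε : ℝ, 0 < ε → PseudoOrbit g ε x y ∧ PseudoOrbit g ε y x}

/-- `C` is a chain-recurrent class of `g`. -/
def IsChainClass (g : X → X) (C : Set X) : Prop :=
  ∃ x : X, ChainRecurrent g x ∧ C = ChainClass g x

/-- The stable set of a set `C`: points whose forward orbit converges to `C`. -/
def Wstab (g : X → X) (C : Set X) : Set X :=
  {x | Tendsto (fun k : ℕ => infDist (g^[k] x) C) atTop (𝓝 0)}

/-- The unstable set of a set `C`: points whose backward orbit converges to `C`. -/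
def Wunstab (f : X ≃ₜ X) (C : Set X) : Set X :=
  {x | Tendsto (fun k : ℕ => infDist ((⇑f.symm)^[k] x) C) atTop (𝓝 0)}

/-- The `n`-th iterate of a homeomorphism, for `n : ℤ`. -/
def zIter (f : X ≃ₜ X) (n : ℤ) : X → X :=
  if 0 ≤ n then (⇑f)^[n.toNat] else (⇑f.symm)^[(-n).toNat]

/-- Kato's property for the constant `m`: any subcontinuum of diameter greater than `c/2`
attains diameter greater than `c` within `m` iterates (forward or backward). -/
def KatoProperty (f : X ≃ₜ X) (c : ℝ) (m : ℕ) : Prop :=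
  ∀ C : Set X, Subcontinuum C → c / 2 < diam C →
    ∃ n : ℤ, |n| ≤ (m : ℤ) ∧ c < diam (zIter f n '' C)

/-- The function `ρ(C) = α^{-N(C)}`, where `N(C)` is the least `|n|` with
`diam(fⁿ(C)) > c` (and `ρ(C) = 0` if no such `n` exists, e.g. for singletons). -/
noncomputable def rho (f : X ≃ₜ X) (c α : ℝ) (C : Set X) : ℝ :=
  sSup {r : ℝ | ∃ n : ℤ, r = α ^ (-|n|) ∧ c < diam (zIter f n '' C)}

/-- The function `P(C_(p,q)) = inf Σ ρ(A_i)` over chains of subcontinua covering `C`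
from `p` to `q`. -/
noncomputable def Pfun (f : X ≃ₜ X) (c α : ℝ) (p q : X) (C : Set X) : ℝ :=
  sInf {s : ℝ | ∃ (n : ℕ) (A : ℕ → Set X) (a : ℕ → X),
    1 ≤ n ∧ a 0 = p ∧ a n = q ∧
    (∀ i < n, Subcontinuum (A i) ∧ a i ∈ A i ∧ a (i + 1) ∈ A i) ∧
    C = ⋃ i ∈ Finset.range n, A i ∧
    s = ∑ i ∈ Finset.range n, rho f c α (A i)}

/-- The function `D'(C_(p,q)) = max_{|i| ≤ n₀ - 1} P(f^i(C_(p,q)))/λ^{|i|}`. -/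
noncomputable def Dprime (f : X ≃ₜ X) (c α lam : ℝ) (n₀ : ℕ) (p q : X) (C : Set X) : ℝ :=
  sSup {r : ℝ | ∃ i : ℤ, |i| ≤ (n₀ : ℤ) - 1 ∧
    r = Pfun f c α (zIter f i p) (zIter f i q) (zIter f i '' C) / lam ^ |i|}

/-! ### Weighted suprema over a two-sided orbit -/

/-- The supremum of `θ ^ |n| * h n` over all integers `n`. -/
noncomputable def weightedSup (θ : ℝ) (h : ℤ → ℝ) : ℝ := ⨆ n : ℤ, θ ^ n.natAbs * h n

section WeightedSup

variable {θ : ℝ} {h : ℤ → ℝ}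

theorem pow_natAbs_mul_le_one (hθ : θ ∈ Ioo (0 : ℝ) 1) (h1 : ∀ n, h n ≤ 1) (n : ℤ) :
    θ ^ n.natAbs * h n ≤ 1 := by
  have h2 : θ ^ n.natAbs ≤ 1 := pow_le_one₀ hθ.1.le hθ.2.le
  have h3 : 0 ≤ θ ^ n.natAbs := pow_nonneg hθ.1.le _
  nlinarith [h1 n]

theorem le_weightedSup (hθ : θ ∈ Ioo (0 : ℝ) 1) (h1 : ∀ n, h n ≤ 1) (n : ℤ) :
    θ ^ n.natAbs * h n ≤ weightedSup θ h :=
  le_ciSup (f := fun n : ℤ => θ ^ n.natAbs * h n)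
    ⟨1, by rintro _ ⟨m, rfl⟩; exact pow_natAbs_mul_le_one hθ h1 m⟩ n

theorem weightedSup_le {b : ℝ} (hb : ∀ n : ℤ, θ ^ n.natAbs * h n ≤ b) : weightedSup θ h ≤ b :=
  ciSup_le hb

theorem apply_zero_le_weightedSup (hθ : θ ∈ Ioo (0 : ℝ) 1) (h1 : ∀ n, h n ≤ 1) :
    h 0 ≤ weightedSup θ h := by
  simpa using le_weightedSup hθ h1 0

/-- If the term of index zero is dominated by another one, the larger of the weighted suprema of
the two shifted sequences is exactly `θ⁻¹` times the original one. -/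
theorem max_weightedSup_shift (hθ : θ ∈ Ioo (0 : ℝ) 1) (h0 : ∀ n, 0 ≤ h n) (h1 : ∀ n, h n ≤ 1)
    (hex : ∃ n : ℤ, n ≠ 0 ∧ h 0 ≤ θ ^ n.natAbs * h n) :
    max (weightedSup θ fun n => h (n + 1)) (weightedSup θ fun n => h (n - 1)) =
      θ⁻¹ * weightedSup θ h := by
  have hpos := hθ.1
  have key : ∀ (a b : ℕ) (k : ℤ), b ≤ a + 1 → θ ^ a * h k ≤ θ⁻¹ * (θ ^ b * h k) := by
    intro a b k hab
    have h2 : θ ^ (a + 1) ≤ θ ^ b := pow_le_pow_of_le_one hθ.1.le hθ.2.le hab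
    calc θ ^ a * h k = θ⁻¹ * (θ ^ (a + 1) * h k) := by field_simp; ring
      _ ≤ θ⁻¹ * (θ ^ b * h k) := by
          have := h0 k
          gcongr
  apply le_antisymm
  · refine max_le (weightedSup_le fun n => ?_) (weightedSup_le fun n => ?_)
    · refine (key _ (n + 1).natAbs _ (by omega)).trans ?_
      gcongr
      exact le_weightedSup hθ h1 _
    · refine (key _ (n - 1).natAbs _ (by omega)).trans ?_
      gcongr
      exact le_weightedSup hθ h1 _
  · rw [inv_mul_le_iff₀ hpos]
    have hne : ∀ n : ℤ, n ≠ 0 → θ ^ n.natAbs * h n ≤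
        θ * max (weightedSup θ fun n => h (n + 1)) (weightedSup θ fun n => h (n - 1)) := by
      intro n hn
      rcases lt_or_gt_of_ne hn with hn | hn
      · have e : θ ^ n.natAbs * h n = θ * (θ ^ (n + 1).natAbs * h (n + 1 - 1)) := by
          rw [show n.natAbs = (n + 1).natAbs + 1 by omega, pow_succ, add_sub_cancel_right]
          ring
        rw [e]
        gcongr
        exact (le_weightedSup (h := fun n => h (n - 1)) hθ (fun _ => h1 _) (n + 1)).trans
          (le_max_right _ _)
      · have e : θ ^ n.natAbs * h n = θ * (θ ^ (n - 1).natAbs * h (n - 1 + 1)) := by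
          rw [show n.natAbs = (n - 1).natAbs + 1 by omega, pow_succ, sub_add_cancel]
          ring
        rw [e]
        gcongr
        exact (le_weightedSup (h := fun n => h (n + 1)) hθ (fun _ => h1 _) (n - 1)).trans
          (le_max_left _ _)
    refine weightedSup_le fun n => ?_
    by_cases hn : n = 0
    · obtain ⟨m, hm, hle⟩ := hex
      subst hn
      simpa using hle.trans (hne m hm)
    · exact hne n hn

end WeightedSup

/-- A bounded nonnegative sequence satisfying `max (d (n + 2)) (d n) = μ * d (n + 1)` with
`1 < μ` decays geometrically. -/
theorem eq_pow_mul_of_max_eq_mul {d : ℕ → ℝ} {μ b : ℝ} (hμ : 1 < μ) (h0 : ∀ n, 0 ≤ d n)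
    (hb : ∀ n, d n ≤ b) (hmax : ∀ n, max (d (n + 2)) (d n) = μ * d (n + 1)) (n : ℕ) :
    d n = μ⁻¹ ^ n * d 0 := by
  have hμ0 : 0 < μ := one_pos.trans hμ
  have step : ∀ n, d n = μ * d (n + 1) := by
    intro n
    by_contra hne
    have hlt : d n < μ * d (n + 1) := lt_of_le_of_ne (hmax n ▸ le_max_right _ _) hne
    have hpos : 0 < d (n + 1) := by
      have := h0 n
      by_contra hcon
      nlinarith
    have grow : ∀ k, 0 < d (n + 1 + k) ∧ d (n + 1 + k) = μ ^ k * d (n + 1) ∧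
        d (n + k) < μ * d (n + 1 + k) := by
      intro k
      induction k with
      | zero => simpa using ⟨hpos, hlt⟩
      | succ k ih =>
        obtain ⟨hk0, hk, hk'⟩ := ih
        have e : d (n + k + 2) = μ * d (n + k + 1) := by
          have hm := hmax (n + k)
          rw [show n + 1 + k = n + k + 1 by ring] at hk'
          rcases max_choice (d (n + k + 2)) (d (n + k)) with h | h
          · rw [← hm, h]
          · rw [h] at hm
            exact absurd hm hk'.ne
        rw [show n + 1 + k = n + k + 1 by ring] at hk0 hk
        rw [show n + 1 + (k + 1) = n + k + 2 by ring, show n + (k + 1) = n + k + 1 by ring, e]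
        refine ⟨by positivity, by rw [hk]; ring, ?_⟩
        nlinarith [mul_pos hμ0 hk0]
    obtain ⟨k, hk⟩ := pow_unbounded_of_one_lt (b / d (n + 1)) hμ
    rw [div_lt_iff₀ hpos, ← (grow k).2.1] at hk
    exact (hb _).not_gt hk
  induction n with
  | zero => simp
  | succ n ih =>
    have := step n
    rw [pow_succ, mul_right_comm, ← ih, this]
    field_simp

/-! ### Chains of sets and the chain infimum -/

/-- A Frink-type chain estimate: a function `R` of intervals of natural numbers which is at most
twice the maximum of its values on three consecutive pieces is at most twice any additive
function dominating it on singletons. -/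
theorem le_two_mul_sum_of_le_two_mul_max {R : ℕ → ℕ → ℝ} {w : ℕ → ℝ} {N : ℕ}
    (hw : ∀ k, 0 ≤ w k) (hsingle : ∀ k, R k (k + 1) ≤ w k) (hempty : ∀ k, R k k ≤ 0)
    (hR : ∀ i u j, i ≤ u → u < j → j ≤ N →
      R i j ≤ 2 * max (R i u) (max (R u (u + 1)) (R (u + 1) j))) :
    ∀ i j, i ≤ j → j ≤ N → R i j ≤ 2 * ∑ k ∈ Finset.Ico i j, w k := by
  suffices H : ∀ l i j, i ≤ j → j ≤ N → j - i = l → R i j ≤ 2 * ∑ k ∈ Finset.Ico i j, w k from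
    fun i j hij hj => H _ i j hij hj rfl
  intro l
  induction l using Nat.strong_induction_on with
  | _ l ih =>
  intro i j hij hj hl
  rcases hij.eq_or_lt with rfl | hlt
  · simpa using hempty i
  set s := ∑ k ∈ Finset.Ico i j, w k with hs
  have hs0 : 0 ≤ s := Finset.sum_nonneg fun k _ => hw k
  have hex : ∃ u, i ≤ u ∧ s / 2 ≤ ∑ k ∈ Finset.Ico i (u + 1), w k := by
    refine ⟨j - 1, by omega, ?_⟩
    rw [Nat.sub_add_cancel (by omega), ← hs]
    linarith
  classical
  obtain ⟨hiu, hsu⟩ := Nat.find_spec hex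
  have huj : Nat.find hex ≤ j - 1 := by
    refine Nat.find_min' hex ⟨by omega, ?_⟩
    rw [Nat.sub_add_cancel (by omega), ← hs]
    linarith
  have hmin : ∀ m < Nat.find hex, ¬ _ := fun m hm => Nat.find_min hex hm
  generalize Nat.find hex = u at *
  have hleft : ∑ k ∈ Finset.Ico i u, w k ≤ s / 2 := by
    rcases hiu.eq_or_lt with rfl | hiu'
    · simpa using div_nonneg hs0 zero_le_two
    · have h2 := hmin (u - 1) (by omega)
      rw [Nat.sub_add_cancel (by omega)] at h2
      push Not at h2
      exact (h2 (by omega)).le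
  have hsplit : ∑ k ∈ Finset.Ico i (u + 1), w k + ∑ k ∈ Finset.Ico (u + 1) j, w k = s :=
    Finset.sum_Ico_consecutive _ (by omega) (by omega)
  have hmid : w u ≤ s :=
    Finset.single_le_sum (f := w) (fun k _ => hw k) (Finset.mem_Ico.2 ⟨hiu, by omega⟩)
  have h1 := ih (u - i) (by omega) i u hiu (by omega) rfl
  have h2 := ih (j - (u + 1)) (by omega) (u + 1) j (by omega) hj rfl
  refine (hR i u j hiu (by omega) hj).trans ?_
  gcongr
  refine max_le (by linarith) (max_le ((hsingle u).trans hmid) (by linarith))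

/-- `A 0, …, A (n - 1)` is a chain of preconnected sets with union `C` joining `p` to `q` through
the points `a 0, …, a n`. -/
structure IsSetChain (p q : X) (C : Set X) (n : ℕ) (A : ℕ → Set X) (a : ℕ → X) : Prop where
  zero : a 0 = p
  last : a n = q
  preconnected : ∀ i < n, IsPreconnected (A i)
  mem : ∀ i < n, a i ∈ A i
  mem_succ : ∀ i < n, a (i + 1) ∈ A i
  iUnion : C = ⋃ i ∈ Finset.range n, A i

/-- The infimum of `∑ ρ (A i)` over all chains of preconnected sets with union `C` joining
`p` to `q`. -/
noncomputable def chainInf (ρ : Set X → ℝ) (p q : X) (C : Set X) : ℝ :=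
  sInf {s : ℝ | ∃ n A a, IsSetChain p q C n A a ∧ s = ∑ i ∈ Finset.range n, ρ (A i)}

section ChainInf

variable {p q r : X} {C B : Set X} {n m : ℕ} {A A' : ℕ → Set X} {a a' : ℕ → X} {ρ : Set X → ℝ}

theorem IsSetChain.single (hC : IsPreconnected C) (hp : p ∈ C) (hq : q ∈ C) :
    IsSetChain p q C 1 (fun _ => C) (fun k => if k = 0 then p else q) where
  zero := by simp
  last := by simp
  preconnected _ _ := hC
  mem i hi := by simpa [Nat.lt_one_iff.1 hi] using hp
  mem_succ i hi := by simpa using hq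
  iUnion := by simp

theorem IsSetChain.reverse (h : IsSetChain p q C n A a) :
    IsSetChain q p C n (fun i => A (n - 1 - i)) (fun i => a (n - i)) where
  zero := by simpa using h.last
  last := by simpa using h.zero
  preconnected i hi := h.preconnected _ (by omega)
  mem i hi := by
    have := h.mem_succ (n - 1 - i) (by omega)
    rwa [show n - 1 - i + 1 = n - i by omega] at this
  mem_succ i hi := by
    have := h.mem (n - 1 - i) (by omega)
    rwa [show n - (i + 1) = n - 1 - i by omega]
  iUnion := by
    rw [h.iUnion]
    ext x
    simp only [Finset.mem_range, mem_iUnion, exists_prop]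
    constructor
    · rintro ⟨i, hi, hx⟩
      exact ⟨n - 1 - i, by omega, by rwa [show n - 1 - (n - 1 - i) = i by omega]⟩
    · rintro ⟨i, hi, hx⟩
      exact ⟨n - 1 - i, by omega, hx⟩

theorem IsSetChain.append (h : IsSetChain p q C n A a) (h' : IsSetChain q r B m A' a') :
    IsSetChain p r (C ∪ B) (n + m) (fun i => if i < n then A i else A' (i - n))
      (fun i => if i < n then a i else a' (i - n)) where
  zero := by
    by_cases hn : 0 < n
    · simp [hn, h.zero]
    · obtain rfl : n = 0 := by omega
      simp [h'.zero, ← h.last, h.zero]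
  last := by simp [h'.last]
  preconnected i hi := by
    split_ifs with hin
    · exact h.preconnected i hin
    · exact h'.preconnected _ (by omega)
  mem i hi := by
    split_ifs with hin
    · exact h.mem i hin
    · exact h'.mem _ (by omega)
  mem_succ i hi := by
    split_ifs with h1 h2 h2
    · exact h.mem_succ i h1
    · obtain rfl : n = i + 1 := by omega
      rw [Nat.sub_self, h'.zero, ← h.last]
      exact h.mem_succ i h1
    · omega
    · rw [show i + 1 - n = i - n + 1 by omega]
      exact h'.mem_succ _ (by omega)
  iUnion := by
    rw [h.iUnion, h'.iUnion]
    ext x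
    simp only [Finset.mem_range, mem_iUnion, exists_prop, mem_union]
    constructor
    · rintro (⟨i, hi, hx⟩ | ⟨i, hi, hx⟩)
      · exact ⟨i, by omega, by simpa [hi] using hx⟩
      · exact ⟨n + i, by omega, by simpa using hx⟩
    · rintro ⟨i, hi, hx⟩
      split_ifs at hx with hin
      · exact Or.inl ⟨i, hin, hx⟩
      · exact Or.inr ⟨i - n, by omega, hx⟩

theorem chainInf_le_sum (hρ : ∀ S, 0 ≤ ρ S) (h : IsSetChain p q C n A a) :
    chainInf ρ p q C ≤ ∑ i ∈ Finset.range n, ρ (A i) := by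
  refine csInf_le ⟨0, ?_⟩ ⟨n, A, a, h, rfl⟩
  rintro _ ⟨n, A, a, -, rfl⟩
  exact Finset.sum_nonneg fun _ _ => hρ _

theorem le_chainInf (hC : IsPreconnected C) (hp : p ∈ C) (hq : q ∈ C) {b : ℝ}
    (hb : ∀ n A a, IsSetChain p q C n A a → b ≤ ∑ i ∈ Finset.range n, ρ (A i)) :
    b ≤ chainInf ρ p q C := by
  refine le_csInf ⟨_, _, _, _, IsSetChain.single hC hp hq, rfl⟩ ?_
  rintro _ ⟨n, A, a, h, rfl⟩
  exact hb n A a h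

theorem chainInf_nonneg (hρ : ∀ S, 0 ≤ ρ S) : 0 ≤ chainInf ρ p q C := by
  refine Real.sInf_nonneg ?_
  rintro _ ⟨n, A, a, -, rfl⟩
  exact Finset.sum_nonneg fun _ _ => hρ _

theorem chainInf_le (hρ : ∀ S, 0 ≤ ρ S) (hC : IsPreconnected C) (hp : p ∈ C) (hq : q ∈ C) :
    chainInf ρ p q C ≤ ρ C := by
  simpa using chainInf_le_sum hρ (IsSetChain.single hC hp hq)

theorem chainInf_comm (hρ : ∀ S, 0 ≤ ρ S) (hC : IsPreconnected C) (hp : p ∈ C) (hq : q ∈ C) :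
    chainInf ρ p q C = chainInf ρ q p C := by
  have key : ∀ {p q : X}, p ∈ C → q ∈ C → chainInf ρ p q C ≤ chainInf ρ q p C := by
    intro p q hp hq
    refine le_chainInf hC hq hp fun n A a h => ?_
    refine (chainInf_le_sum hρ h.reverse).trans_eq ?_
    exact Finset.sum_range_reflect (fun i => ρ (A i)) n
  exact le_antisymm (key hp hq) (key hq hp)

theorem chainInf_union_le (hρ : ∀ S, 0 ≤ ρ S) (hC : IsPreconnected C) (hB : IsPreconnected B)
    (hp : p ∈ C) (hq : q ∈ C) (hq' : q ∈ B) (hr : r ∈ B) :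
    chainInf ρ p r (C ∪ B) ≤ chainInf ρ p q C + chainInf ρ q r B := by
  rw [← sub_le_iff_le_add]
  refine le_chainInf hC hp hq fun n A a h => ?_
  rw [sub_le_comm]
  refine le_chainInf hB hq' hr fun m A' a' h' => ?_
  rw [sub_le_iff_le_add']
  refine (chainInf_le_sum hρ (h.append h')).trans_eq ?_
  rw [Finset.sum_range_add]
  congr 1
  · refine Finset.sum_congr rfl fun i hi => ?_
    rw [if_pos (Finset.mem_range.1 hi)]
  · simp

theorem IsSetChain.isPreconnected_biUnion_Ico (h : IsSetChain p q C n A a) {i j : ℕ}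
    (hj : j ≤ n) : IsPreconnected (⋃ k ∈ Ico i j, A k) := by
  refine IsPreconnected.biUnion_of_chain ordConnected_Ico
    (fun k hk => h.preconnected k (hk.2.trans_le hj)) fun k hk hk' => ?_
  rw [Order.succ_eq_add_one] at hk' ⊢
  exact ⟨a (k + 1), h.mem_succ k (hk.2.trans_le hj), h.mem (k + 1) (hk'.2.trans_le hj)⟩

/-- If `ρ` of a union of three consecutive preconnected sets is at most twice the maximum of the
values of `ρ`, then the chain infimum is at least half of `ρ`. -/
theorem le_two_mul_chainInf (hρ : ∀ S, 0 ≤ ρ S) (hempty : ρ ∅ = 0)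
    (hρ3 : ∀ L S R : Set X, IsPreconnected L → IsPreconnected S → IsPreconnected R →
      (L.Nonempty → (L ∩ S).Nonempty) → (R.Nonempty → (S ∩ R).Nonempty) →
      ρ (L ∪ S ∪ R) ≤ 2 * max (ρ L) (max (ρ S) (ρ R)))
    (hC : IsPreconnected C) (hp : p ∈ C) (hq : q ∈ C) :
    ρ C ≤ 2 * chainInf ρ p q C := by
  rw [← div_le_iff₀' two_pos]
  refine le_chainInf hC hp hq fun n A a h => ?_
  rw [div_le_iff₀' two_pos]
  have hsingle : ∀ u, ⋃ k ∈ Ico u (u + 1), A k = A u := fun u => by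
    rw [show Ico u (u + 1) = {u} by ext; simp; omega, biUnion_singleton]
  have key := le_two_mul_sum_of_le_two_mul_max (N := n)
    (R := fun i j => ρ (⋃ k ∈ Ico i j, A k)) (w := fun k => ρ (A k)) (fun k => hρ _)
    (fun k => (congrArg ρ (hsingle k)).le)
    (fun k => by simp [hempty]) ?_ 0 n n.zero_le le_rfl
  · simpa [h.iUnion, ← Finset.range_eq_Ico] using key
  intro i u j hiu huj hj
  have hunion : ⋃ k ∈ Ico i j, A k =
      (⋃ k ∈ Ico i u, A k) ∪ (⋃ k ∈ Ico u (u + 1), A k) ∪ ⋃ k ∈ Ico (u + 1) j, A k := by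
    rw [← biUnion_union, ← biUnion_union, Ico_union_Ico_eq_Ico hiu u.le_succ,
      Ico_union_Ico_eq_Ico (by omega) (by omega)]
  rw [hunion]
  refine hρ3 _ _ _ (h.isPreconnected_biUnion_Ico (by omega))
    (h.isPreconnected_biUnion_Ico (by omega)) (h.isPreconnected_biUnion_Ico hj) ?_ ?_
  · rintro ⟨x, hx⟩
    simp only [mem_iUnion, exists_prop] at hx
    obtain ⟨k, hk, -⟩ := hx
    have hk' := hk.1.trans_lt hk.2
    rw [hsingle]
    refine ⟨a u, mem_biUnion (x := u - 1) ⟨by omega, by omega⟩ ?_, h.mem u (by omega)⟩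
    have := h.mem_succ (u - 1) (by omega)
    rwa [Nat.sub_add_cancel (by omega)] at this
  · rintro ⟨x, hx⟩
    simp only [mem_iUnion, exists_prop] at hx
    obtain ⟨k, hk, -⟩ := hx
    have hk' := hk.1.trans_lt hk.2
    rw [hsingle]
    exact ⟨a (u + 1), h.mem_succ u (by omega),
      mem_biUnion (x := u + 1) ⟨le_rfl, hk'⟩ (h.mem (u + 1) (by omega))⟩

end ChainInf

/-! ### Limits of connected sets and escape times -/

/-- The set of limits of a family of sets along a filter. -/
def limitSet {ι Y : Type*} [TopologicalSpace Y] (l : Filter ι) (C : ι → Set Y) : Set Y :=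
  {x | ∀ U ∈ 𝓝 x, ∀ᶠ k in l, (C k ∩ U).Nonempty}

section LimitSet

variable {ι Y : Type*} [TopologicalSpace Y] {l : Ultrafilter ι} {C : ι → Set Y}

theorem mem_limitSet_of_tendsto {x : ι → Y} {y : Y} (hx : ∀ᶠ k in l, x k ∈ C k)
    (hy : Tendsto x l (𝓝 y)) : y ∈ limitSet (l : Filter ι) C := by
  intro U hU
  filter_upwards [hx, hy hU] with k h1 h2
  exact ⟨x k, h1, h2⟩

theorem isClosed_limitSet : IsClosed (limitSet (l : Filter ι) C) := by
  rw [← isOpen_compl_iff, isOpen_iff_mem_nhds]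
  intro x hx
  simp only [limitSet, mem_compl_iff, mem_ofPred_eq, not_forall] at hx
  obtain ⟨U, hU, hCU⟩ := hx
  filter_upwards [eventually_mem_nhds_iff.2 hU] with y hy hyL
  exact hCU (hyL U hy)

theorem exists_tendsto_ultrafilter [CompactSpace Y] (l : Ultrafilter ι) (x : ι → Y) :
    ∃ y, Tendsto x l (𝓝 y) := by
  obtain ⟨y, -, hy⟩ := isCompact_univ.ultrafilter_le_nhds (l.map x) (by simp)
  exact ⟨y, hy⟩

theorem eventually_subset_of_limitSet_subset [CompactSpace Y] {U : Set Y} (hU : IsOpen U)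
    (hLU : limitSet (l : Filter ι) C ⊆ U) : ∀ᶠ k in l, C k ⊆ U := by
  classical
  by_contra hcon
  rw [← Ultrafilter.eventually_not] at hcon
  obtain ⟨k₀, hk₀⟩ := hcon.exists
  obtain ⟨x₀, -⟩ := not_subset.1 hk₀
  have hch : ∀ k, ∃ x, ¬ C k ⊆ U → x ∈ C k ∧ x ∉ U := fun k => by
    by_cases h : C k ⊆ U
    · exact ⟨x₀, fun h' => absurd h h'⟩
    · obtain ⟨x, hx⟩ := not_subset.1 h
      exact ⟨x, fun _ => hx⟩
  choose x hx using hch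
  obtain ⟨y, hy⟩ := exists_tendsto_ultrafilter l x
  have hyU : y ∈ U := hLU (mem_limitSet_of_tendsto (hcon.mono fun k hk => (hx k hk).1) hy)
  obtain ⟨k, hk, hkU⟩ := (hcon.and (hy (hU.mem_nhds hyU))).exists
  exact (hx k hk).2 hkU

theorem isPreconnected_limitSet [CompactSpace Y] [T2Space Y]
    (hC : ∀ k, IsPreconnected (C k)) : IsPreconnected (limitSet (l : Filter ι) C) := by
  intro u v hu hv huv ⟨x, hxL, hxu⟩ ⟨y, hyL, hyv⟩
  by_contra hcon
  rw [not_nonempty_iff_eq_empty] at hcon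
  have hL : IsClosed (limitSet (l : Filter ι) C) := isClosed_limitSet
  have hmem : ∀ z ∈ limitSet (l : Filter ι) C, z ∈ u → z ∉ v := fun z hz h1 h2 =>
    (hcon ▸ ⟨hz, h1, h2⟩ : z ∈ (∅ : Set Y))
  obtain ⟨U, V, hU, hV, hLU, hLV, hUV⟩ := normal_separation (hL.inter hv.isClosed_compl)
    (hL.inter hu.isClosed_compl) (disjoint_left.2 fun z hz hz' =>
      (huv hz.1).elim hz'.2 hz.2)
  have hsub : limitSet (l : Filter ι) C ⊆ U ∪ V := fun z hz => by
    by_cases hzv : z ∈ v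
    · exact Or.inr (hLV ⟨hz, fun hzu => hmem z hz hzu hzv⟩)
    · exact Or.inl (hLU ⟨hz, hzv⟩)
  obtain ⟨k, hk, hkU, hkV⟩ := ((eventually_subset_of_limitSet_subset (hU.union hV) hsub).and
    ((hxL U (hU.mem_nhds (hLU ⟨hxL, hmem x hxL hxu⟩))).and
      (hyL V (hV.mem_nhds (hLV ⟨hyL, fun hyu => hmem y hyL hyu hyv⟩))))).exists
  obtain ⟨z, -, hzU, hzV⟩ := hC k U V hU hV hk hkU hkV
  exact disjoint_left.1 hUV hzU hzV

end LimitSet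

section Escape

variable {f : X ≃ₜ X} {c : ℝ}

theorem coe_pow_eq_iterate (f : X ≃ₜ X) (n : ℕ) : ⇑(f ^ n) = (⇑f)^[n] := by
  induction n with
  | zero => rfl
  | succ n ih =>
    rw [pow_succ, Function.iterate_succ, ← ih]
    rfl

theorem coe_zpow_natCast (f : X ≃ₜ X) (n : ℕ) : ⇑(f ^ (n : ℤ)) = (⇑f)^[n] := by
  rw [zpow_natCast, coe_pow_eq_iterate]

theorem coe_zpow_neg_natCast (f : X ≃ₜ X) (n : ℕ) : ⇑(f ^ (-(n : ℤ))) = (⇑f.symm)^[n] := by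
  rw [zpow_neg, ← inv_zpow, zpow_natCast, coe_pow_eq_iterate]
  rfl

theorem zpow_add_image (f : X ≃ₜ X) (m n : ℤ) (C : Set X) :
    ⇑(f ^ (m + n)) '' C = ⇑(f ^ m) '' (⇑(f ^ n) '' C) := by
  rw [zpow_add, image_image]
  rfl

/-- A connected set whose iterates all stay small is a point. -/
theorem CwExpansiveConst.subsingleton (hc : CwExpansiveConst f c) {C : Set X}
    (hC : IsPreconnected C)
    (h : ∀ n : ℤ, ∀ x ∈ C, ∀ y ∈ C, dist ((f ^ n) x) ((f ^ n) y) ≤ c) : C.Subsingleton := by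
  intro x hx y hy
  refine hc.2 x C (fun z hz => ⟨fun n => ?_, fun n => ?_⟩) hC hx hy
  · have := h n x hx z hz
    rwa [coe_zpow_natCast] at this
  · have := h (-n) x hx z hz
    rwa [coe_zpow_neg_natCast] at this

variable [CompactSpace X]

theorem dist_le_diam {C : Set X} {x y : X} (hx : x ∈ C) (hy : y ∈ C) : dist x y ≤ diam C :=
  dist_le_diam_of_mem (isCompact_univ.isBounded.subset (subset_univ C)) hx hy

/-- Connected sets which are not small become larger than an expansivity constant within a
uniformly bounded number of iterates. -/
theorem CwExpansiveConst.exists_escape_time (hc : CwExpansiveConst f c) {δ : ℝ} (hδ : 0 < δ) :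
    ∃ m : ℕ, ∀ C : Set X, IsPreconnected C → δ ≤ diam C →
      ∃ n : ℤ, n.natAbs ≤ m ∧ c < diam (⇑(f ^ n) '' C) := by
  by_contra! hcon
  choose C hC hdiam hsmall using hcon
  have hxy : ∀ k, ∃ x ∈ C k, ∃ y ∈ C k, δ / 2 ≤ dist x y := by
    intro k
    by_contra! h
    have := diam_le_of_forall_dist_le (half_pos hδ).le fun x hx y hy => (h x hx y hy).le
    linarith [hdiam k]
  choose x hx y hy hxy using hxy
  let l : Ultrafilter ℕ := Ultrafilter.of atTop
  have hl : (l : Filter ℕ) ≤ atTop := Ultrafilter.of_le _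
  obtain ⟨x', hx'⟩ := exists_tendsto_ultrafilter l x
  obtain ⟨y', hy'⟩ := exists_tendsto_ultrafilter l y
  have hd : δ / 2 ≤ dist x' y' :=
    ge_of_tendsto' (hx'.dist hy') hxy
  have hsub : (limitSet (l : Filter ℕ) C).Subsingleton := by
    refine hc.subsingleton (isPreconnected_limitSet hC) fun n u hu v hv => ?_
    by_contra! hlt
    have ho : IsOpen {p : X × X | c < dist ((f ^ n) p.1) ((f ^ n) p.2)} :=
      isOpen_lt continuous_const (by fun_prop)
    obtain ⟨U, V, hU, hV, huU, hvV, hUV⟩ := isOpen_prod_iff.1 ho u v hlt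
    obtain ⟨k, ⟨a, haC, haU⟩, ⟨b, hbC, hbV⟩, hk⟩ := ((hu U (hU.mem_nhds huU)).and
      ((hv V (hV.mem_nhds hvV)).and (hl (eventually_ge_atTop n.natAbs)))).exists
    have h1 : c < dist ((f ^ n) a) ((f ^ n) b) := hUV (mk_mem_prod haU hbV)
    exact absurd (h1.trans_le (dist_le_diam (mem_image_of_mem _ haC) (mem_image_of_mem _ hbC)))
      (hsmall k n hk).not_gt
  have := hsub (mem_limitSet_of_tendsto (Eventually.of_forall hx) hx')
    (mem_limitSet_of_tendsto (Eventually.of_forall hy) hy')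
  rw [this, dist_self] at hd
  linarith

end Escape

/-! ### The self-similar cw-metric -/

/-- The supremum of `(θ ^ 2) ^ |n|` over the integers `n` such that `f ^ n` maps `C` to a set of
diameter larger than `c`. -/
noncomputable def escapeSize (f : X ≃ₜ X) (c θ : ℝ) (C : Set X) : ℝ :=
  weightedSup (θ ^ 2) fun n => if c < diam (⇑(f ^ n) '' C) then 1 else 0

/-- The weighted supremum along the orbit of the chain infimum of `escapeSize`. -/
noncomputable def selfSimilarDist (f : X ≃ₜ X) (c θ : ℝ) (p q : X) (C : Set X) : ℝ :=
  weightedSup θ fun n =>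
    chainInf (escapeSize f c θ) ((f ^ n) p) ((f ^ n) q) (⇑(f ^ n) '' C)

section EscapeSize

variable {f : X ≃ₜ X} {c θ : ℝ} {C : Set X}

theorem sq_mem_Ioo (hθ : θ ∈ Ioo (0 : ℝ) 1) : θ ^ 2 ∈ Ioo (0 : ℝ) 1 :=
  ⟨pow_pos hθ.1 2, pow_lt_one₀ hθ.1.le hθ.2 two_ne_zero⟩

theorem le_escapeSize (hθ : θ ∈ Ioo (0 : ℝ) 1) {n : ℤ} (hn : c < diam (⇑(f ^ n) '' C)) :
    (θ ^ 2) ^ n.natAbs ≤ escapeSize f c θ C := by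
  have := le_weightedSup (h := fun n : ℤ => if c < diam (⇑(f ^ n) '' C) then (1 : ℝ) else 0)
    (sq_mem_Ioo hθ) (fun n => by split_ifs <;> norm_num) n
  simpa only [escapeSize, hn, if_true, mul_one] using this

theorem escapeSize_le {b : ℝ} (hb : 0 ≤ b)
    (h : ∀ n : ℤ, c < diam (⇑(f ^ n) '' C) → (θ ^ 2) ^ n.natAbs ≤ b) :
    escapeSize f c θ C ≤ b := by
  refine weightedSup_le fun n => ?_
  split_ifs with hn
  · simpa using h n hn
  · simpa using hb

theorem escapeSize_nonneg (f : X ≃ₜ X) (c θ : ℝ) (C : Set X) : 0 ≤ escapeSize f c θ C := by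
  refine Real.iSup_nonneg fun n => mul_nonneg (by positivity) ?_
  dsimp only
  split_ifs <;> norm_num

theorem escapeSize_le_one (hθ : θ ∈ Ioo (0 : ℝ) 1) : escapeSize f c θ C ≤ 1 :=
  escapeSize_le zero_le_one fun _ _ => pow_le_one₀ (sq_mem_Ioo hθ).1.le (sq_mem_Ioo hθ).2.le

theorem escapeSize_of_subsingleton (hc : 0 ≤ c) (hC : C.Subsingleton) :
    escapeSize f c θ C = 0 := by
  refine le_antisymm (escapeSize_le le_rfl fun n hn => ?_) (escapeSize_nonneg ..)
  rw [diam_subsingleton (hC.image _)] at hn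
  exact absurd hn hc.not_gt

/-- Applying an iterate changes `escapeSize` by at most the corresponding power. -/
theorem pow_mul_escapeSize_image_le (hθ : θ ∈ Ioo (0 : ℝ) 1) (k : ℤ) :
    (θ ^ 2) ^ k.natAbs * escapeSize f c θ (⇑(f ^ k) '' C) ≤ escapeSize f c θ C := by
  have hθ2 := sq_mem_Ioo hθ
  have hpos : 0 < (θ ^ 2) ^ k.natAbs := pow_pos hθ2.1 _
  rw [← le_div_iff₀' hpos]
  refine escapeSize_le (div_nonneg (escapeSize_nonneg ..) hpos.le) fun n hn => ?_
  rw [le_div_iff₀' hpos, ← pow_add]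
  rw [← zpow_add_image] at hn
  refine le_trans ?_ (le_escapeSize hθ hn)
  exact pow_le_pow_of_le_one hθ2.1.le hθ2.2.le (by omega)

/-- A set of small `escapeSize` is expanded by an iterate or its inverse. -/
theorem escapeSize_le_pow_mul_max (hθ : θ ∈ Ioo (0 : ℝ) 1) (k : ℕ)
    (hC : escapeSize f c θ C ≤ (θ ^ 2) ^ k) :
    escapeSize f c θ C ≤ (θ ^ 2) ^ k * max (escapeSize f c θ (⇑(f ^ (k : ℤ)) '' C))
      (escapeSize f c θ (⇑(f ^ (-k : ℤ)) '' C)) := by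
  have hθ2 := sq_mem_Ioo hθ
  refine escapeSize_le (mul_nonneg (pow_pos hθ2.1 _).le
    (le_max_of_le_left (escapeSize_nonneg ..))) fun n hn => ?_
  have hkn : k ≤ n.natAbs :=
    (pow_le_pow_iff_right_of_lt_one₀ hθ2.1 hθ2.2).1 ((le_escapeSize hθ hn).trans hC)
  rw [← Nat.add_sub_cancel' hkn, pow_add]
  gcongr
  rcases le_total 0 n with h0 | h0
  · refine le_max_of_le_left ?_
    rw [show n.natAbs - k = (n - k).natAbs by omega]
    refine le_escapeSize hθ ?_
    rwa [← zpow_add_image, sub_add_cancel]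
  · refine le_max_of_le_right ?_
    rw [show n.natAbs - k = (n + k).natAbs by omega]
    refine le_escapeSize hθ ?_
    rwa [← zpow_add_image, add_neg_cancel_right]

theorem diam_union_le_of_nonempty_imp {S T : Set X}
    (h : (S.Nonempty ∧ T.Nonempty) → (S ∩ T).Nonempty) : diam (S ∪ T) ≤ diam S + diam T := by
  rcases S.eq_empty_or_nonempty with rfl | hS
  · simp
  rcases T.eq_empty_or_nonempty with rfl | hT
  · simp
  · exact diam_union' (h ⟨hS, hT⟩)

/-- If connected sets of diameter larger than `c / 3` reach diameter larger than `c` within `m`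
iterates and `(θ ^ 2) ^ m = 1 / 2`, then `escapeSize` satisfies a three-set inequality. -/
theorem escapeSize_union_le (hθ : θ ∈ Ioo (0 : ℝ) 1) {m : ℕ}
    (hm : ∀ C : Set X, IsPreconnected C → c / 3 ≤ diam C →
      ∃ n : ℤ, n.natAbs ≤ m ∧ c < diam (⇑(f ^ n) '' C))
    (hθm : (θ ^ 2) ^ m = 1 / 2) {L S R : Set X} (hL : IsPreconnected L) (hS : IsPreconnected S)
    (hR : IsPreconnected R) (hLS : L.Nonempty → (L ∩ S).Nonempty)
    (hSR : R.Nonempty → (S ∩ R).Nonempty) :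
    escapeSize f c θ (L ∪ S ∪ R) ≤
      2 * max (escapeSize f c θ L) (max (escapeSize f c θ S) (escapeSize f c θ R)) := by
  have hθ2 := sq_mem_Ioo hθ
  refine escapeSize_le (mul_nonneg zero_le_two (le_max_of_le_left (escapeSize_nonneg ..)))
    fun n hn => ?_
  have large : ∀ T : Set X, IsPreconnected T → c / 3 ≤ diam (⇑(f ^ n) '' T) →
      (θ ^ 2) ^ n.natAbs ≤ 2 * escapeSize f c θ T := by
    intro T hT hdT
    obtain ⟨k, hk, hck⟩ := hm _ (hT.image _ (f ^ n).continuous.continuousOn) hdT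
    rw [← zpow_add_image] at hck
    have h1 : (θ ^ 2) ^ (m + n.natAbs) ≤ (θ ^ 2) ^ (k + n).natAbs :=
      pow_le_pow_of_le_one hθ2.1.le hθ2.2.le (by omega)
    rw [pow_add, hθm] at h1
    linarith [le_escapeSize hθ hck]
  have hdiam : diam (⇑(f ^ n) '' (L ∪ S ∪ R)) ≤
      diam (⇑(f ^ n) '' L) + diam (⇑(f ^ n) '' S) + diam (⇑(f ^ n) '' R) := by
    rw [image_union, image_union]
    refine (diam_union_le_of_nonempty_imp fun h => ?_).trans ?_
    · obtain ⟨x, hxS, hxR⟩ := hSR h.2.of_image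
      exact ⟨_, Or.inr (mem_image_of_mem _ hxS), mem_image_of_mem _ hxR⟩
    · gcongr
      refine diam_union_le_of_nonempty_imp fun h => ?_
      obtain ⟨x, hxL, hxS⟩ := hLS h.1.of_image
      exact ⟨_, mem_image_of_mem _ hxL, mem_image_of_mem _ hxS⟩
  by_cases h1 : c / 3 ≤ diam (⇑(f ^ n) '' L)
  · exact (large L hL h1).trans (by gcongr; exact le_max_left _ _)
  by_cases h2 : c / 3 ≤ diam (⇑(f ^ n) '' S)
  · exact (large S hS h2).trans
      (by gcongr; exact (le_max_left _ _).trans (le_max_right _ _))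
  by_cases h3 : c / 3 ≤ diam (⇑(f ^ n) '' R)
  · exact (large R hR h3).trans
      (by gcongr; exact (le_max_right _ _).trans (le_max_right _ _))
  · linarith

/-- Sets of small diameter have small `escapeSize`. -/
theorem exists_diam_lt_imp_escapeSize_lt [CompactSpace X] (hc : 0 < c)
    (hθ : θ ∈ Ioo (0 : ℝ) 1) {δ : ℝ} (hδ : 0 < δ) :
    ∃ γ > 0, ∀ C : Set X, diam C < γ → escapeSize f c θ C < δ := by
  have hθ2 := sq_mem_Ioo hθ
  obtain ⟨M, hM⟩ := exists_pow_lt_of_lt_one hδ hθ2.2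
  have hev : ∀ᶠ γ in 𝓝[>] (0 : ℝ), ∀ n ∈ Finset.Icc (-M : ℤ) M, ∀ x y : X, dist x y < γ →
      dist ((f ^ n) x) ((f ^ n) y) < c := by
    rw [Filter.eventually_all_finset]
    intro n _
    obtain ⟨γ, hγ, h⟩ := Metric.uniformContinuous_iff.1
      (CompactSpace.uniformContinuous_of_continuous (f ^ n).continuous) c hc
    filter_upwards [Ioo_mem_nhdsGT hγ] with γ' hγ' x y hxy
    exact h (hxy.trans hγ'.2)
  obtain ⟨γ, hγ, hγ0⟩ := (hev.and self_mem_nhdsWithin).exists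
  refine ⟨γ, hγ0, fun C hC => ?_⟩
  refine (escapeSize_le (pow_pos hθ2.1 M).le fun n hn => ?_).trans_lt hM
  refine pow_le_pow_of_le_one hθ2.1.le hθ2.2.le ?_
  by_contra! hlt
  refine hn.not_ge (diam_le_of_forall_dist_le hc.le ?_)
  rintro _ ⟨x, hx, rfl⟩ _ ⟨y, hy, rfl⟩
  exact (hγ n (Finset.mem_Icc.2 (by omega)) x y ((dist_le_diam hx hy).trans_lt hC)).le

end EscapeSize

section SelfSimilarDist

variable {f : X ≃ₜ X} {c θ : ℝ} {C B : Set X} {p q r : X}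

theorem chainInf_escapeSize_le (f : X ≃ₜ X) (c θ : ℝ) (hC : IsPreconnected C) (hp : p ∈ C)
    (hq : q ∈ C) (n : ℤ) :
    chainInf (escapeSize f c θ) ((f ^ n) p) ((f ^ n) q) (⇑(f ^ n) '' C) ≤
      escapeSize f c θ (⇑(f ^ n) '' C) :=
  chainInf_le (escapeSize_nonneg f c θ) (hC.image _ (f ^ n).continuous.continuousOn)
    (mem_image_of_mem _ hp) (mem_image_of_mem _ hq)

theorem chainInf_escapeSize_le_one (hθ : θ ∈ Ioo (0 : ℝ) 1) (hC : IsPreconnected C) (hp : p ∈ C)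
    (hq : q ∈ C) (n : ℤ) :
    chainInf (escapeSize f c θ) ((f ^ n) p) ((f ^ n) q) (⇑(f ^ n) '' C) ≤ 1 :=
  (chainInf_escapeSize_le f c θ hC hp hq n).trans (escapeSize_le_one hθ)

theorem selfSimilarDist_nonneg (hθ : θ ∈ Ioo (0 : ℝ) 1) : 0 ≤ selfSimilarDist f c θ p q C :=
  Real.iSup_nonneg fun _ =>
    mul_nonneg (pow_nonneg hθ.1.le _) (chainInf_nonneg (escapeSize_nonneg f c θ))

theorem selfSimilarDist_comm (hC : IsPreconnected C) (hp : p ∈ C) (hq : q ∈ C) :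
    selfSimilarDist f c θ p q C = selfSimilarDist f c θ q p C := by
  unfold selfSimilarDist
  congr 1
  ext n
  exact chainInf_comm (escapeSize_nonneg f c θ) (hC.image _ (f ^ n).continuous.continuousOn)
    (mem_image_of_mem _ hp) (mem_image_of_mem _ hq)

theorem selfSimilarDist_union_le (hθ : θ ∈ Ioo (0 : ℝ) 1) (hC : IsPreconnected C)
    (hB : IsPreconnected B) (hp : p ∈ C) (hq : q ∈ C) (hq' : q ∈ B) (hr : r ∈ B) :
    selfSimilarDist f c θ p r (C ∪ B) ≤
      selfSimilarDist f c θ p q C + selfSimilarDist f c θ q r B := by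
  refine weightedSup_le fun n => ?_
  have hpow : 0 ≤ θ ^ n.natAbs := pow_nonneg hθ.1.le _
  have h := chainInf_union_le (escapeSize_nonneg f c θ)
    (hC.image _ (f ^ n).continuous.continuousOn) (hB.image _ (f ^ n).continuous.continuousOn)
    (mem_image_of_mem _ hp) (mem_image_of_mem _ hq) (mem_image_of_mem _ hq')
    (mem_image_of_mem _ hr)
  rw [image_union]
  refine (mul_le_mul_of_nonneg_left h hpow).trans ?_
  rw [mul_add]
  exact add_le_add
    (le_weightedSup hθ (chainInf_escapeSize_le_one hθ hC hp hq) n)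
    (le_weightedSup hθ (chainInf_escapeSize_le_one hθ hB hq' hr) n)

theorem selfSimilarDist_sq_le (hθ : θ ∈ Ioo (0 : ℝ) 1) (hC : IsPreconnected C) (hp : p ∈ C)
    (hq : q ∈ C) : selfSimilarDist f c θ p q C ^ 2 ≤ escapeSize f c θ C := by
  refine (Real.le_sqrt (selfSimilarDist_nonneg hθ) (escapeSize_nonneg ..)).1 ?_
  refine weightedSup_le fun n => Real.le_sqrt_of_sq_le ?_
  set e := escapeSize f c θ (⇑(f ^ n) '' C) with he
  have he0 : 0 ≤ e := escapeSize_nonneg ..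
  have hle := chainInf_escapeSize_le f c θ hC hp hq n
  have h0 := chainInf_nonneg (p := (f ^ n) p) (q := (f ^ n) q) (C := ⇑(f ^ n) '' C)
    (escapeSize_nonneg f c θ)
  calc (θ ^ n.natAbs * chainInf (escapeSize f c θ) ((f ^ n) p) ((f ^ n) q) (⇑(f ^ n) '' C)) ^ 2
      ≤ (θ ^ n.natAbs * e) ^ 2 := by
        have := hθ.1.le
        gcongr
    _ = (θ ^ 2) ^ n.natAbs * e * e := by rw [mul_pow, ← pow_mul, ← pow_mul, mul_comm 2]; ring
    _ ≤ (θ ^ 2) ^ n.natAbs * e * 1 := by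
        gcongr
        exact escapeSize_le_one hθ
    _ ≤ escapeSize f c θ C := by
        rw [mul_one]
        exact pow_mul_escapeSize_image_le hθ n

theorem chainInf_le_selfSimilarDist (hθ : θ ∈ Ioo (0 : ℝ) 1) (hC : IsPreconnected C) (hp : p ∈ C)
    (hq : q ∈ C) : chainInf (escapeSize f c θ) p q C ≤ selfSimilarDist f c θ p q C := by
  have h := apply_zero_le_weightedSup hθ (chainInf_escapeSize_le_one (f := f) (c := c) hθ hC hp hq)
  have e : ⇑(f ^ (0 : ℤ)) = id := rfl
  simpa only [selfSimilarDist, e, id_eq, image_id'] using h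

/-- The exact expansion of `selfSimilarDist` at small scales. -/
theorem max_selfSimilarDist_image (hθ : θ ∈ Ioo (0 : ℝ) 1) {k : ℕ} (hk : k ≠ 0)
    (hθk : θ ^ k = 1 / 2)
    (hhalf : ∀ (C : Set X) (p q : X), IsPreconnected C → p ∈ C → q ∈ C →
      escapeSize f c θ C ≤ 2 * chainInf (escapeSize f c θ) p q C)
    (hC : IsPreconnected C) (hp : p ∈ C) (hq : q ∈ C)
    (hsmall : selfSimilarDist f c θ p q C ≤ 1 / 8) :
    max (selfSimilarDist f c θ (f p) (f q) (⇑f '' C))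
      (selfSimilarDist f c θ (f.symm p) (f.symm q) (⇑f.symm '' C)) =
      θ⁻¹ * selfSimilarDist f c θ p q C := by
  have himage : ∀ n : ℤ, escapeSize f c θ (⇑(f ^ n) '' C) ≤
      2 * chainInf (escapeSize f c θ) ((f ^ n) p) ((f ^ n) q) (⇑(f ^ n) '' C) := fun n =>
    hhalf _ _ _ (hC.image _ (f ^ n).continuous.continuousOn) (mem_image_of_mem _ hp)
      (mem_image_of_mem _ hq)
  have hquarter : (θ ^ 2) ^ k = 1 / 4 := by
    rw [← pow_mul, mul_comm, pow_mul, hθk]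
    norm_num
  have hsize : escapeSize f c θ C ≤ (θ ^ 2) ^ k := by
    rw [hquarter]
    linarith [hhalf C p q hC hp hq, chainInf_le_selfSimilarDist (f := f) (c := c) hθ hC hp hq]
  have hexp := escapeSize_le_pow_mul_max hθ k hsize
  rw [hquarter] at hexp
  have h0 : chainInf (escapeSize f c θ) ((f ^ (0 : ℤ)) p) ((f ^ (0 : ℤ)) q) (⇑(f ^ (0 : ℤ)) '' C) ≤
      escapeSize f c θ C := by
    have e : ⇑(f ^ (0 : ℤ)) = id := rfl
    simpa only [e, image_id] using chainInf_escapeSize_le f c θ hC hp hq 0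
  have hmax := max_weightedSup_shift hθ
    (h := fun n => chainInf (escapeSize f c θ) ((f ^ n) p) ((f ^ n) q) (⇑(f ^ n) '' C))
    (fun _ => chainInf_nonneg (escapeSize_nonneg f c θ))
    (chainInf_escapeSize_le_one hθ hC hp hq) ?_
  · have e1 : ∀ n : ℤ, ∀ x, (f ^ (n + 1)) x = (f ^ n) (f x) := fun n x => by
      rw [zpow_add_one]; rfl
    have e2 : ∀ n : ℤ, ∀ x, (f ^ (n - 1)) x = (f ^ n) (f.symm x) := fun n x => by
      rw [zpow_sub_one]; rfl
    simpa only [selfSimilarDist, image_image, e1, e2] using hmax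
  · rcases max_choice (escapeSize f c θ (⇑(f ^ (k : ℤ)) '' C))
      (escapeSize f c θ (⇑(f ^ (-k : ℤ)) '' C)) with h | h <;> rw [h] at hexp
    · refine ⟨k, by simpa using hk, ?_⟩
      rw [Int.natAbs_natCast, hθk]
      linarith [himage k]
    · refine ⟨-k, by simpa using hk, ?_⟩
      rw [Int.natAbs_neg, Int.natAbs_natCast, hθk]
      linarith [himage (-k)]

end SelfSimilarDist

theorem Subcontinuum.image {C : Set X} (hC : Subcontinuum C) (g : X ≃ₜ X) :
    Subcontinuum (⇑g '' C) :=
  ⟨hC.1.image g.continuous, hC.2.image _ g.continuous.continuousOn⟩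

theorem Subcontinuum.iterate_image {C : Set X} (hC : Subcontinuum C) (g : X ≃ₜ X) (n : ℕ) :
    Subcontinuum ((⇑g)^[n] '' C) := by
  rw [← coe_pow_eq_iterate]
  exact hC.image _

/-- Self-similarity implies the exponential decay of hyperbolicity. -/
theorem SelfSimilarWith.iterate_eq {g : X ≃ₜ X} {D : X → X → Set X → ℝ} {ξ lam : ℝ}
    (h : SelfSimilarWith g D ξ lam) (hlam : 1 < lam)
    (h0 : ∀ (C : Set X) (p q : X), Subcontinuum C → p ∈ C → q ∈ C → 0 ≤ D p q C)
    {C : Set X} {p q : X} (hC : Subcontinuum C) (hp : p ∈ C) (hq : q ∈ C)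
    (hsmall : ∀ n : ℕ, D ((⇑g)^[n] p) ((⇑g)^[n] q) ((⇑g)^[n] '' C) ≤ ξ) (n : ℕ) :
    D ((⇑g)^[n] p) ((⇑g)^[n] q) ((⇑g)^[n] '' C) = lam⁻¹ ^ n * D p q C := by
  have hmem : ∀ (n : ℕ) {x : X}, x ∈ C → (⇑g)^[n] x ∈ (⇑g)^[n] '' C := fun n x hx =>
    mem_image_of_mem _ hx
  have key := eq_pow_mul_of_max_eq_mul
    (d := fun n => D ((⇑g)^[n] p) ((⇑g)^[n] q) ((⇑g)^[n] '' C)) (b := ξ) hlam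
    (fun n => h0 _ _ _ (hC.iterate_image g n) (hmem n hp) (hmem n hq)) hsmall (fun n => ?_) n
  · simpa using key
  · have := h _ _ _ (hC.iterate_image g (n + 1)) (hmem _ hp) (hmem _ hq) (hsmall (n + 1))
    have e : ∀ x, g.symm ((⇑g)^[n + 1] x) = (⇑g)^[n] x := fun x => by
      rw [Function.iterate_succ_apply', g.symm_apply_apply]
    rw [image_image, image_image] at this
    simp only [e] at this
    simp only [Function.iterate_succ_apply' (⇑g) (n + 1)]
    exact this

theorem SelfSimilarWith.symm {g : X ≃ₜ X} {D : X → X → Set X → ℝ} {ξ lam : ℝ}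
    (h : SelfSimilarWith g D ξ lam) : SelfSimilarWith g.symm D ξ lam :=
  fun C p q hC hp hq hD => by
    rw [max_comm]
    exact h C p q hC hp hq hD

/-- Every cw-expansive homeomorphism of a Peano continuum admits a self-similar
hyperbolic cw-metric. -/
theorem exists_selfSimilar_hyperbolic_cwMetric
    [CompactSpace X] [ConnectedSpace X] [LocallyConnectedSpace X]
    (f : X ≃ₜ X) (hf : ∃ c : ℝ, CwExpansiveConst f c) :
    ∃ (D : X → X → Set X → ℝ) (ξ lam : ℝ),
      IsHypCwMetric f D ∧ 0 < ξ ∧ 1 < lam ∧ SelfSimilarWith f D ξ lam := by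
  obtain ⟨c, hc⟩ := hf
  obtain ⟨m₀, hm₀⟩ := hc.exists_escape_time (div_pos hc.1 three_pos)
  let m := m₀ + 1
  have hm : ∀ C : Set X, IsPreconnected C → c / 3 ≤ diam C →
      ∃ n : ℤ, n.natAbs ≤ m ∧ c < diam (⇑(f ^ n) '' C) := fun C hC hd => by
    obtain ⟨n, hn, h⟩ := hm₀ C hC hd
    exact ⟨n, hn.trans m₀.le_succ, h⟩
  have hm2 : 2 * m ≠ 0 := by omega
  let θ : ℝ := (1 / 2 : ℝ) ^ (((2 * m : ℕ) : ℝ)⁻¹)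
  have hθk : θ ^ (2 * m) = 1 / 2 := Real.rpow_inv_natCast_pow (by norm_num) hm2
  have hθ : θ ∈ Ioo (0 : ℝ) 1 :=
    ⟨Real.rpow_pos_of_pos (by norm_num) _,
      Real.rpow_lt_one (by norm_num) (by norm_num)
        (inv_pos.2 (Nat.cast_pos.2 (Nat.pos_of_ne_zero hm2)))⟩
  have hθm : (θ ^ 2) ^ m = 1 / 2 := by rw [← pow_mul, hθk]
  have hhalf : ∀ (C : Set X) (p q : X), IsPreconnected C → p ∈ C → q ∈ C →
      escapeSize f c θ C ≤ 2 * chainInf (escapeSize f c θ) p q C := fun C p q hC hp hq =>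
    le_two_mul_chainInf (escapeSize_nonneg f c θ)
      (escapeSize_of_subsingleton hc.1.le subsingleton_empty)
      (fun L S R hL hS hR => escapeSize_union_le hθ hm hθm hL hS hR) hC hp hq
  have hD0 : ∀ (C : Set X) (p q : X), Subcontinuum C → p ∈ C → q ∈ C →
      0 ≤ selfSimilarDist f c θ p q C := fun C p q _ _ _ => selfSimilarDist_nonneg hθ
  have hlam : 1 < θ⁻¹ := (one_lt_inv₀ hθ.1).2 hθ.2
  have hself : SelfSimilarWith f (selfSimilarDist f c θ) (1 / 8) θ⁻¹ :=
    fun C p q hC hp hq hD =>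
      max_selfSimilarDist_image hθ hm2 hθk hhalf hC.2.isPreconnected hp hq hD
  have hsmall : ∀ δ : ℝ, 0 < δ → ∃ γ > 0, ∀ (C : Set X) (p q : X), Subcontinuum C → p ∈ C →
      q ∈ C → diam C < γ → selfSimilarDist f c θ p q C < δ := fun δ hδ => by
    obtain ⟨γ, hγ, h⟩ := exists_diam_lt_imp_escapeSize_lt (f := f) hc.1 hθ (pow_pos hδ 2)
    exact ⟨γ, hγ, fun C p q hC hp hq hd => lt_of_pow_lt_pow_left₀ 2 hδ.le
      ((selfSimilarDist_sq_le hθ hC.2.isPreconnected hp hq).trans_lt (h C hd))⟩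
  have hlarge : ∀ δ : ℝ, 0 < δ → ∃ γ > 0, ∀ (C : Set X) (p q : X), Subcontinuum C → p ∈ C →
      q ∈ C → selfSimilarDist f c θ p q C < γ → diam C < δ := fun δ hδ => by
    obtain ⟨M, hM⟩ := hc.exists_escape_time hδ
    have hθ2 := sq_mem_Ioo hθ
    refine ⟨(θ ^ 2) ^ M / 2, half_pos (pow_pos hθ2.1 M), fun C p q hC hp hq hD => ?_⟩
    by_contra! hd
    obtain ⟨n, hn, hcn⟩ := hM C hC.2.isPreconnected hd
    have h1 : (θ ^ 2) ^ M ≤ (θ ^ 2) ^ n.natAbs := pow_le_pow_of_le_one hθ2.1.le hθ2.2.le hn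
    linarith [le_escapeSize hθ hcn, hhalf C p q hC.2.isPreconnected hp hq,
      chainInf_le_selfSimilarDist (f := f) (c := c) hθ hC.2.isPreconnected hp hq]
  refine ⟨selfSimilarDist f c θ, 1 / 8, θ⁻¹, ?_, by norm_num, hlam, hself⟩
  refine ⟨hD0, fun C p q hC hp hq => ⟨fun h => ?_, ?_⟩,
    fun C p q hC hp hq => selfSimilarDist_comm hC.2.isPreconnected hp hq,
    fun A B a b d hA hB ha hb hb' hd =>
      selfSimilarDist_union_le hθ hA.2.isPreconnected hB.2.isPreconnected ha hb hb' hd, ?_,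
    fun δ hδ => ?_⟩
  · refine ⟨p, (subset_singleton_iff.2 fun x hx => ?_).antisymm (singleton_subset_iff.2 hp)⟩
    by_contra hne
    obtain ⟨γ, hγ, hlt⟩ := hlarge _ (dist_pos.2 hne)
    exact (hlt C p q hC hp hq (h.trans_lt hγ)).not_ge (dist_le_diam hx hp)
  · rintro ⟨z, rfl⟩
    refine pow_eq_zero_iff two_ne_zero |>.1 (le_antisymm ?_ (sq_nonneg _))
    rw [← escapeSize_of_subsingleton (f := f) (θ := θ) hc.1.le (subsingleton_singleton (a := z))]
    exact selfSimilarDist_sq_le hθ hC.2.isPreconnected hp hq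
  · obtain ⟨γ, hγ, hlt⟩ := hsmall (1 / 8) (by norm_num)
    have decay : ∀ g : X ≃ₜ X, SelfSimilarWith g (selfSimilarDist f c θ) (1 / 8) θ⁻¹ →
        ∀ (C : Set X) (p q : X), Subcontinuum C → p ∈ C → q ∈ C →
        (∀ n : ℕ, diam ((⇑g)^[n] '' C) ≤ γ / 2) → ∀ n : ℕ,
        selfSimilarDist f c θ ((⇑g)^[n] p) ((⇑g)^[n] q) ((⇑g)^[n] '' C) ≤
          4 * θ ^ n * selfSimilarDist f c θ p q C := by
      intro g hg C p q hC hp hq hd n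
      rw [hg.iterate_eq hlam hD0 hC hp hq (fun n => (hlt _ _ _ (hC.iterate_image g n)
        (mem_image_of_mem _ hp) (mem_image_of_mem _ hq)
        ((hd n).trans_lt (half_lt_self hγ))).le) n, inv_inv, mul_assoc]
      have := mul_nonneg (pow_nonneg hθ.1.le n) (hD0 C p q hC hp hq)
      linarith
    exact ⟨θ, hθ, γ / 2, half_pos hγ, decay f hself, decay f.symm hself.symm⟩
  · obtain ⟨γ₁, hγ₁, h₁⟩ := hsmall δ hδ
    obtain ⟨γ₂, hγ₂, h₂⟩ := hlarge δ hδ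
    exact ⟨min γ₁ γ₂, lt_min hγ₁ hγ₂,
      fun C p q hC hp hq hd => h₁ C p q hC hp hq (hd.trans_le (min_le_left _ _)),
      fun C p q hC hp hq hd => h₂ C p q hC hp hq (hd.trans_le (min_le_right _ _))⟩

end CwDyn
end

section
/- With the construction below, there exists δ>0 (one may take δ=1/(4αλ^{n₀−1})) such that for every C_(p,q)∈E with D'(C_(p,q))≤δ one has max{D'(f(C_(p,q))), D'(f⁻¹(C_(p,q)))} ≥ λ·D'(C_(p,q)). -/
open Metric Set Filter Topology

namespace CwDyn

variable {X : Type*} [MetricSpace X]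

theorem zIter_eq (f : X ≃ₜ X) (n : ℤ) (x : X) :
    zIter f n x = ((f.toEquiv : Equiv.Perm X) ^ n) x := by
  unfold zIter
  split_ifs with h
  · lift n to ℕ using h
    simp [← Equiv.Perm.iterate_eq_pow]
  · obtain ⟨k, rfl⟩ : ∃ k : ℕ, n = -(k : ℤ) := ⟨(-n).toNat, by omega⟩
    simp only [neg_neg, Int.toNat_natCast, zpow_neg, zpow_natCast, ← inv_pow]
    rw [← Equiv.Perm.iterate_eq_pow]
    rfl

theorem zIter_add (f : X ≃ₜ X) (m n : ℤ) (x : X) :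
    zIter f (m + n) x = zIter f m (zIter f n x) := by
  simp [zIter_eq, zpow_add]

theorem zIter_zero (f : X ≃ₜ X) (x : X) : zIter f 0 x = x := by
  simp [zIter_eq]

theorem zIter_one (f : X ≃ₜ X) (x : X) : zIter f 1 x = f x := by
  simp [zIter_eq]

theorem zIter_neg_one (f : X ≃ₜ X) (x : X) : zIter f (-1) x = f.symm x := by
  simp only [zIter_eq, zpow_neg, zpow_one]
  rfl

theorem image_zIter_add (f : X ≃ₜ X) (m n : ℤ) (C : Set X) :
    zIter f (m + n) '' C = zIter f m '' (zIter f n '' C) := by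
  rw [Set.image_image]
  exact Set.image_congr fun x _ => zIter_add f m n x

theorem continuous_zIter (f : X ≃ₜ X) (n : ℤ) : Continuous (zIter f n) := by
  unfold zIter
  split_ifs
  · exact f.continuous.iterate _
  · exact f.symm.continuous.iterate _

theorem Subcontinuum.image_zIter {C : Set X} (hC : Subcontinuum C) (f : X ≃ₜ X) (n : ℤ) :
    Subcontinuum (zIter f n '' C) :=
  ⟨hC.1.image (continuous_zIter f n), hC.2.image _ (continuous_zIter f n).continuousOn⟩

section Rho

variable {f : X ≃ₜ X} {c α : ℝ}

theorem le_rho (hα : 1 < α) {C : Set X} {n : ℤ} (h : c < diam (zIter f n '' C)) :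
    α ^ (-|n|) ≤ rho f c α C := by
  refine le_csSup ⟨1, ?_⟩ ⟨n, rfl, h⟩
  rintro _ ⟨k, rfl, -⟩
  exact zpow_le_one_of_nonpos₀ hα.le (by simp)

theorem rho_nonneg (hα : 1 < α) (C : Set X) : 0 ≤ rho f c α C := by
  refine Real.sSup_nonneg ?_
  rintro _ ⟨k, rfl, -⟩
  positivity

/-- The supremum defining `rho` is attained, unless all iterates of `C` are small. -/
theorem rho_eq_zero_or (hα : 1 < α) (C : Set X) :
    rho f c α C = 0 ∨ ∃ n : ℤ, rho f c α C = α ^ (-|n|) ∧ c < diam (zIter f n '' C) := by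
  classical
  by_cases h : ∃ k : ℕ, ∃ n : ℤ, n.natAbs = k ∧ c < diam (zIter f n '' C)
  · right
    obtain ⟨n, hn, hd⟩ := Nat.find_spec h
    refine ⟨n, le_antisymm (csSup_le ⟨_, n, rfl, hd⟩ ?_) (le_rho hα hd), hd⟩
    rintro _ ⟨k, rfl, hk⟩
    have := Nat.find_min' h ⟨k, rfl, hk⟩
    exact zpow_le_zpow_right₀ hα.le (by rw [Int.abs_eq_natAbs, Int.abs_eq_natAbs]; omega)
  · left
    have : {r : ℝ | ∃ n : ℤ, r = α ^ (-|n|) ∧ c < diam (zIter f n '' C)} = ∅ := by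
      refine Set.eq_empty_of_forall_notMem ?_
      rintro _ ⟨n, rfl, hn⟩
      exact h ⟨_, n, rfl, hn⟩
    rw [rho, this, Real.sSup_empty]

theorem rho_le_two_mul_rho_of_half_lt {m : ℕ} (hm : KatoProperty f c m) (hα : 1 < α)
    (hα2 : α ^ m = 2) {A : Set X} (hA : Subcontinuum A) {n : ℤ}
    (h : c / 2 < diam (zIter f n '' A)) : α ^ (-|n|) ≤ 2 * rho f c α A := by
  obtain ⟨k, hk, hd⟩ := hm _ (hA.image_zIter f n) h
  rw [← image_zIter_add] at hd
  have h0 : 0 < α := by linarith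
  have hle : -|n| ≤ (m : ℤ) + -|k + n| := by linarith [abs_add_le k n]
  calc α ^ (-|n|) ≤ α ^ ((m : ℤ) + -|k + n|) := zpow_le_zpow_right₀ hα.le hle
    _ = 2 * α ^ (-|k + n|) := by rw [zpow_add₀ h0.ne', zpow_natCast, hα2]
    _ ≤ 2 * rho f c α A := by gcongr; exact le_rho hα hd

theorem rho_union_le {m : ℕ} (hm : KatoProperty f c m) (hα : 1 < α)
    (hα2 : α ^ m = 2) {A B : Set X} (hA : Subcontinuum A) (hB : Subcontinuum B)
    (hAB : (A ∩ B).Nonempty) :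
    rho f c α (A ∪ B) ≤ 2 * max (rho f c α A) (rho f c α B) := by
  rcases rho_eq_zero_or (f := f) (c := c) hα (A ∪ B) with h | ⟨n, h, hd⟩
  · rw [h]
    have := (rho_nonneg (f := f) (c := c) hα A).trans (le_max_left _ (rho f c α B))
    linarith
  · rw [h]
    have hu : diam (zIter f n '' (A ∪ B)) ≤ diam (zIter f n '' A) + diam (zIter f n '' B) := by
      rw [Set.image_union]
      refine diam_union' ?_
      obtain ⟨x, hx⟩ := hAB
      exact ⟨_, Set.mem_image_of_mem _ hx.1, Set.mem_image_of_mem _ hx.2⟩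
    rcases lt_or_ge (c / 2) (diam (zIter f n '' A)) with h1 | h1
    · refine (rho_le_two_mul_rho_of_half_lt hm hα hα2 hA h1).trans ?_
      gcongr
      exact le_max_left _ _
    · refine (rho_le_two_mul_rho_of_half_lt hm hα hα2 hB (n := n) (by linarith)).trans ?_
      gcongr
      exact le_max_right _ _

end Rho

/-- Frink's chain inequality: a function of intervals which is quasi-subadditive with
constant `2` is bounded by four times the sum over unit intervals, the two extreme ones
being counted only twice. -/
theorem frink_chain_le (F : ℕ → ℕ → ℝ) (N : ℕ) (h0 : ∀ i, 0 ≤ F i (i + 1))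
    (hF : ∀ i k j, i < k → k < j → j ≤ N → F i j ≤ 2 * max (F i k) (F k j)) :
    ∀ n i, i + n + 2 ≤ N → F i (i + n + 2) ≤
      4 * ∑ l ∈ Finset.range (i + n + 2), F l (l + 1) - 4 * ∑ l ∈ Finset.range i, F l (l + 1)
        - 2 * F i (i + 1) - 2 * F (i + n + 1) (i + n + 2) := by
  intro n
  induction n using Nat.strong_induction_on with
  | _ n ih =>
  intro i hi
  set S : ℕ → ℝ := fun j => ∑ l ∈ Finset.range j, F l (l + 1) with hS
  have hs : ∀ j, S (j + 1) = S j + F j (j + 1) := fun j => Finset.sum_range_succ _ _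
  have hmono : Monotone S := monotone_nat_of_le_succ fun j => by linarith [hs j, h0 j]
  change F i (i + n + 2) ≤ 4 * S (i + n + 2) - 4 * S i - 2 * F i (i + 1)
    - 2 * F (i + n + 1) (i + n + 2)
  have e1 := hs (i + n + 1)
  have e2 := hs i
  have e3 := hmono (show i + 1 ≤ i + n + 1 by omega)
  have e4 := h0 i
  have e5 := h0 (i + n + 1)
  by_contra! hlt
  set a := F i (i + n + 2) with ha
  -- every terminal interval is large: otherwise two shorter overlapping intervals bound `a`
  have key : ∀ k, k ≤ n → F (i + k + 1) (i + n + 2) ≥ a / 2 := by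
    intro k
    induction k with
    | zero =>
      intro _
      have := hF i (i + 1) (i + n + 2) (by omega) (by omega) hi
      rcases le_max_iff.1 ((div_le_iff₀' two_pos).2 this) with h | h
      · linarith
      · exact h
    | succ k ihk =>
      intro hk
      have hprev := ihk (by omega)
      have := hF i (i + k + 2) (i + n + 2) (by omega) (by omega) hi
      rcases le_max_iff.1 ((div_le_iff₀' two_pos).2 this) with h | h
      · have b1 := ih k (by omega) i (by omega)
        obtain ⟨d, rfl⟩ : ∃ d, n = k + 1 + d := ⟨n - k - 1, by omega⟩
        have b2 := ih d (by omega) (i + k + 1) (by omega)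
        rw [show i + k + 1 + d + 2 = i + (k + 1 + d) + 2 by ring,
          show i + k + 1 + d + 1 = i + (k + 1 + d) + 1 by ring] at b2
        change _ ≤ 4 * S _ - 4 * S _ - _ - _ at b1 b2
        have := hs (i + k + 1)
        linarith
      · exact h
  have := key n le_rfl
  linarith

theorem frink_chain_le_four_mul (F : ℕ → ℕ → ℝ) (N : ℕ) (hN : 1 ≤ N)
    (h0 : ∀ i, 0 ≤ F i (i + 1))
    (hF : ∀ i k j, i < k → k < j → j ≤ N → F i j ≤ 2 * max (F i k) (F k j)) :
    F 0 N ≤ 4 * ∑ l ∈ Finset.range N, F l (l + 1) := by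
  obtain rfl | ⟨n, rfl⟩ : N = 1 ∨ ∃ n, N = n + 2 :=
    hN.eq_or_lt.imp Eq.symm fun h => ⟨N - 2, by omega⟩
  · simpa using by linarith [h0 0]
  · have := frink_chain_le F (n + 2) h0 hF n 0 (by omega)
    simp only [Nat.zero_add, Finset.range_zero, Finset.sum_empty] at this
    linarith [h0 0, h0 (n + 1)]

theorem subcontinuum_biUnion_Ico {A : ℕ → Set X} {a : ℕ → X} {n : ℕ}
    (hA : ∀ i < n, Subcontinuum (A i) ∧ a i ∈ A i ∧ a (i + 1) ∈ A i) {i j : ℕ}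
    (hij : i < j) (hj : j ≤ n) : Subcontinuum (⋃ l ∈ Finset.Ico i j, A l) := by
  induction j, hij using Nat.le_induction with
  | base => simpa using (hA i (by omega)).1
  | succ j hij ih =>
    have hins : (⋃ l ∈ Finset.Ico i (j + 1), A l) = (⋃ l ∈ Finset.Ico i j, A l) ∪ A j := by
      ext x
      simp only [Set.mem_iUnion, Finset.mem_Ico, Set.mem_union, exists_prop]
      grind
    have hprev := ih (by omega)
    rw [hins]
    refine ⟨hprev.1.union (hA j (by omega)).1.1, IsConnected.union ?_ hprev.2
      (hA j (by omega)).1.2⟩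
    refine ⟨a j, ?_, (hA j (by omega)).2.1⟩
    simp only [Set.mem_iUnion, Finset.mem_Ico, exists_prop]
    refine ⟨j - 1, by omega, ?_⟩
    have := (hA (j - 1) (by omega)).2.2
    rwa [Nat.sub_add_cancel (by omega)] at this

section Pfun

variable {f : X ≃ₜ X} {c α : ℝ}

theorem Pfun_nonneg (hα : 1 < α) (p q : X) (C : Set X) : 0 ≤ Pfun f c α p q C := by
  refine Real.sInf_nonneg ?_
  rintro _ ⟨n, A, a, -, -, -, -, -, rfl⟩
  exact Finset.sum_nonneg fun i _ => rho_nonneg hα _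

theorem rho_mem_chainSums {C : Set X} {p q : X} (hC : Subcontinuum C) (hp : p ∈ C)
    (hq : q ∈ C) :
    ∃ (n : ℕ) (A : ℕ → Set X) (a : ℕ → X), 1 ≤ n ∧ a 0 = p ∧ a n = q ∧
      (∀ i < n, Subcontinuum (A i) ∧ a i ∈ A i ∧ a (i + 1) ∈ A i) ∧
      C = ⋃ i ∈ Finset.range n, A i ∧
      rho f c α C = ∑ i ∈ Finset.range n, rho f c α (A i) :=
  ⟨1, fun _ => C, fun i => if i = 0 then p else q, le_rfl, by simp, by simp,
    fun i hi => by
      obtain rfl : i = 0 := by omega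
      simpa using ⟨hC, hp, hq⟩, by simp, by simp⟩

theorem Pfun_le_rho (hα : 1 < α) {C : Set X} {p q : X} (hC : Subcontinuum C) (hp : p ∈ C)
    (hq : q ∈ C) : Pfun f c α p q C ≤ rho f c α C := by
  refine csInf_le ⟨0, ?_⟩ (rho_mem_chainSums hC hp hq)
  rintro _ ⟨n, A, a, -, -, -, -, -, rfl⟩
  exact Finset.sum_nonneg fun i _ => rho_nonneg hα _

theorem rho_le_four_mul_Pfun {m : ℕ} (hm : KatoProperty f c m) (hα : 1 < α)
    (hα2 : α ^ m = 2) {C : Set X} {p q : X} (hC : Subcontinuum C) (hp : p ∈ C)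
    (hq : q ∈ C) : rho f c α C ≤ 4 * Pfun f c α p q C := by
  suffices h : rho f c α C / 4 ≤ Pfun f c α p q C by linarith
  refine le_csInf ⟨_, rho_mem_chainSums hC hp hq⟩ ?_
  rintro _ ⟨n, A, a, hn, -, -, hA, rfl, rfl⟩
  have := frink_chain_le_four_mul
    (fun i j => rho f c α (⋃ l ∈ Finset.Ico i j, A l)) n hn
    (fun i => rho_nonneg hα _) (fun i k j hik hkj hj => ?_)
  · simp only [Nat.Ico_succ_singleton, Finset.mem_singleton, Set.iUnion_iUnion_eq_left,
      ← Finset.range_eq_Ico] at this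
    linarith
  · have hU : (⋃ l ∈ Finset.Ico i j, A l) =
        (⋃ l ∈ Finset.Ico i k, A l) ∪ ⋃ l ∈ Finset.Ico k j, A l := by
      ext x
      simp only [Set.mem_iUnion, Finset.mem_Ico, Set.mem_union, exists_prop]
      grind
    simp only [hU]
    refine rho_union_le hm hα hα2 (subcontinuum_biUnion_Ico hA hik (by omega))
      (subcontinuum_biUnion_Ico hA hkj hj) ⟨a k, ?_, ?_⟩
    · simp only [Set.mem_iUnion, Finset.mem_Ico, exists_prop]
      refine ⟨k - 1, by omega, ?_⟩
      have := (hA (k - 1) (by omega)).2.2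
      rwa [Nat.sub_add_cancel (by omega)] at this
    · simp only [Set.mem_iUnion, Finset.mem_Ico, exists_prop]
      exact ⟨k, by omega, (hA k (by omega)).2.1⟩

end Pfun

section Dprime

variable (f : X ≃ₜ X) (c α lam : ℝ) (n₀ : ℕ) (p q : X) (C : Set X)

theorem finite_setOf_Dprime :
    {r : ℝ | ∃ i : ℤ, |i| ≤ (n₀ : ℤ) - 1 ∧
      r = Pfun f c α (zIter f i p) (zIter f i q) (zIter f i '' C) / lam ^ |i|}.Finite := by
  refine ((Set.finite_Icc (-((n₀ : ℤ) - 1)) ((n₀ : ℤ) - 1)).image fun i : ℤ =>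
    Pfun f c α (zIter f i p) (zIter f i q) (zIter f i '' C) / lam ^ |i|).subset ?_
  rintro _ ⟨i, hi, rfl⟩
  exact ⟨i, abs_le.1 hi, rfl⟩

theorem exists_eq_Dprime (hn₀ : 1 ≤ n₀) : ∃ i : ℤ, |i| ≤ (n₀ : ℤ) - 1 ∧
    Dprime f c α lam n₀ p q C =
      Pfun f c α (zIter f i p) (zIter f i q) (zIter f i '' C) / lam ^ |i| :=
  Set.Nonempty.csSup_mem (s := {r : ℝ | ∃ i : ℤ, |i| ≤ (n₀ : ℤ) - 1 ∧
    r = Pfun f c α (zIter f i p) (zIter f i q) (zIter f i '' C) / lam ^ |i|})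
    ⟨_, 0, by simpa using hn₀, rfl⟩ (finite_setOf_Dprime f c α lam n₀ p q C)

variable {n₀} in
theorem le_Dprime {i : ℤ} (hi : |i| ≤ (n₀ : ℤ) - 1) :
    Pfun f c α (zIter f i p) (zIter f i q) (zIter f i '' C) / lam ^ |i| ≤
      Dprime f c α lam n₀ p q C :=
  le_csSup (finite_setOf_Dprime f c α lam n₀ p q C).bddAbove ⟨i, hi, rfl⟩

/-- Shifted form of `le_Dprime`: the iterates of `f ^ e` applied to the triple. -/
theorem le_Dprime_zIter (e : ℤ) {n₀ : ℕ} {i : ℤ} (hi : |i - e| ≤ (n₀ : ℤ) - 1) :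
    Pfun f c α (zIter f i p) (zIter f i q) (zIter f i '' C) / lam ^ |i - e| ≤
      Dprime f c α lam n₀ (zIter f e p) (zIter f e q) (zIter f e '' C) := by
  have := le_Dprime f c α lam (zIter f e p) (zIter f e q) (zIter f e '' C) hi
  simpa only [← zIter_add, ← image_zIter_add, sub_add_cancel] using this

end Dprime

/-- A subcontinuum with small `rho` has its `rho` expanded by `α ^ n₀` under the `n₀`-th
forward or backward iterate. -/
theorem pow_mul_rho_le {f : X ≃ₜ X} {c α : ℝ} (hα : 1 < α) {n₀ : ℕ} {C : Set X}
    (h : rho f c α C < α ^ (-(n₀ : ℤ))) :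
    α ^ n₀ * rho f c α C ≤
      max (rho f c α (zIter f n₀ '' C)) (rho f c α (zIter f (-n₀) '' C)) := by
  rcases rho_eq_zero_or (f := f) (c := c) hα C with h0 | ⟨n, hn, hd⟩
  · rw [h0, mul_zero]
    exact (rho_nonneg hα _).trans (le_max_left _ _)
  · have h0 : α ≠ 0 := by linarith
    rw [hn] at h ⊢
    have hlt := (zpow_lt_zpow_iff_right₀ hα).1 h
    rw [← zpow_natCast, ← zpow_add₀ h0]
    have aux : ∀ e : ℤ, |n - e| = |n| - n₀ →
        α ^ ((n₀ : ℤ) + -|n|) ≤ rho f c α (zIter f e '' C) := by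
      intro e he
      have := le_rho (f := f) (c := c) hα (C := zIter f e '' C) (n := n - e)
        (by rwa [← image_zIter_add, sub_add_cancel])
      rwa [he, neg_sub, sub_eq_add_neg] at this
    rcases le_total 0 n with hs | hs
    · exact le_max_of_le_left (aux _ (by
        rw [abs_of_nonneg hs] at *; rw [abs_of_nonneg (by omega)]))
    · exact le_max_of_le_right (aux _ (by
        rw [abs_of_nonpos hs] at *; rw [abs_of_nonpos (by omega)]; omega))

/-- If `Pfun` is small, it is expanded by `α ^ n₀ / 4` under the `n₀`-th forward or backward
iterate. -/
theorem pow_div_four_mul_Pfun_le {f : X ≃ₜ X} {c α : ℝ} {m : ℕ} (hm : KatoProperty f c m)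
    (hα : 1 < α) (hα2 : α ^ m = 2) {n₀ : ℕ} {C : Set X} {p q : X} (hC : Subcontinuum C)
    (hp : p ∈ C) (hq : q ∈ C) (h : 4 * Pfun f c α p q C < α ^ (-(n₀ : ℤ))) :
    α ^ n₀ / 4 * Pfun f c α p q C ≤
      max (Pfun f c α (zIter f n₀ p) (zIter f n₀ q) (zIter f n₀ '' C))
        (Pfun f c α (zIter f (-n₀) p) (zIter f (-n₀) q) (zIter f (-n₀) '' C)) := by
  have hexp := pow_mul_rho_le hα ((rho_le_four_mul_Pfun hm hα hα2 hC hp hq).trans_lt h)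
  have hle : α ^ n₀ * Pfun f c α p q C ≤ α ^ n₀ * rho f c α C := by
    gcongr
    exact Pfun_le_rho hα hC hp hq
  have aux : ∀ e : ℤ, rho f c α (zIter f e '' C) ≤
      4 * Pfun f c α (zIter f e p) (zIter f e q) (zIter f e '' C) := fun e =>
    rho_le_four_mul_Pfun hm hα hα2 (hC.image_zIter f e) (Set.mem_image_of_mem _ hp)
      (Set.mem_image_of_mem _ hq)
  rcases le_max_iff.1 hexp with h' | h'
  · exact le_max_of_le_left (by linarith [aux n₀])
  · exact le_max_of_le_right (by linarith [aux (-n₀)])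

/-- For the function `D'` built from the construction of the hyperbolic cw-metric,
there exists `δ > 0` such that `D'(C_(p,q)) ≤ δ` implies
`max {D'(f(C_(p,q))), D'(f⁻¹(C_(p,q)))} ≥ λ D'(C_(p,q))`. -/
theorem Dprime_expansion
    [CompactSpace X]
    (f : X ≃ₜ X) (c : ℝ) (hc : CwExpansiveConst f c)
    (m : ℕ) (hm1 : 1 ≤ m) (hm : KatoProperty f c m)
    (α : ℝ) (hα : α = (2 : ℝ) ^ ((m : ℝ))⁻¹)
    (n₀ : ℕ) (hn₀ : 1 ≤ n₀) (hk : 1 < α ^ n₀ / 4)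
    (lam : ℝ) (hlam : lam = (α ^ n₀ / 4) ^ ((n₀ : ℝ))⁻¹) :
    ∃ δ : ℝ, 0 < δ ∧
      ∀ (C : Set X) (p q : X), Subcontinuum C → p ∈ C → q ∈ C →
        Dprime f c α lam n₀ p q C ≤ δ →
        lam * Dprime f c α lam n₀ p q C ≤
          max (Dprime f c α lam n₀ (f p) (f q) (⇑f '' C))
            (Dprime f c α lam n₀ (f.symm p) (f.symm q) (⇑f.symm '' C)) := by
  have hm0 : (m : ℝ) ≠ 0 := by positivity
  have hn0 : (n₀ : ℝ) ≠ 0 := by positivity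
  have hα1 : 1 < α := by
    rw [hα]
    exact Real.one_lt_rpow (by norm_num) (by positivity)
  have hα2 : α ^ m = 2 := by
    rw [hα, Real.rpow_inv_natCast_pow (by norm_num) (by omega)]
  have hlam1 : 1 < lam := by
    rw [hlam]
    exact Real.one_lt_rpow hk (by positivity)
  have hlamn : lam ^ n₀ = α ^ n₀ / 4 := by
    rw [hlam, Real.rpow_inv_natCast_pow (by linarith) (by omega)]
  have hlam0 : 0 < lam := by linarith
  have hf : ⇑f = zIter f 1 := funext fun x => (zIter_one f x).symm
  have hfs : ⇑f.symm = zIter f (-1) := funext fun x => (zIter_neg_one f x).symm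
  refine ⟨α ^ (-(n₀ : ℤ)) / 8, by positivity, fun C p q hC hp hq hδ => ?_⟩
  rw [hf, hfs]
  have hdiv : ∀ (x : ℝ) (k : ℤ), lam * (x / lam ^ k) = x / lam ^ (k - 1) := fun x k => by
    rw [zpow_sub_one₀ hlam0.ne']
    field_simp
  obtain ⟨i, hi, hD⟩ := exists_eq_Dprime f c α lam n₀ p q C hn₀
  rcases lt_trichotomy i 0 with hi0 | rfl | hi0
  · refine le_max_of_le_right ?_
    have habs : |i - (-1)| = |i| - 1 := by
      rw [abs_of_neg hi0, abs_of_nonpos] <;> omega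
    have := le_Dprime_zIter f c α lam p q C (-1) (n₀ := n₀) (i := i) (by omega)
    rwa [hD, hdiv, ← habs]
  · have hP0 : Dprime f c α lam n₀ p q C = Pfun f c α p q C := by
      have hid : zIter f 0 = id := funext (zIter_zero f)
      simpa [hid] using hD
    have hpos : 0 < α ^ (-(n₀ : ℤ)) := by positivity
    have hexp := pow_div_four_mul_Pfun_le hm hα1 hα2 (n₀ := n₀) hC hp hq (by linarith)
    have hpow : lam * Pfun f c α p q C =
        α ^ n₀ / 4 * Pfun f c α p q C / lam ^ ((n₀ : ℤ) - 1) := by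
      rw [← hdiv, zpow_natCast, hlamn]
      field_simp
    rw [hP0, hpow]
    rcases le_max_iff.1 hexp with h | h
    · refine le_max_of_le_left ?_
      have habs : |(n₀ : ℤ) - 1| = n₀ - 1 := abs_of_nonneg (by omega)
      have := le_Dprime_zIter f c α lam p q C 1 (n₀ := n₀) (i := n₀) habs.le
      rw [habs] at this
      exact (by gcongr : _ ≤ _).trans this
    · refine le_max_of_le_right ?_
      have habs : |-(n₀ : ℤ) - (-1)| = n₀ - 1 := by
        rw [abs_of_nonpos] <;> omega
      have := le_Dprime_zIter f c α lam p q C (-1) (n₀ := n₀) (i := -n₀) habs.le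
      rw [habs] at this
      exact (by gcongr : _ ≤ _).trans this
  · refine le_max_of_le_left ?_
    have habs : |i - 1| = |i| - 1 := by
      rw [abs_of_pos hi0, abs_of_nonneg]; omega
    have := le_Dprime_zIter f c α lam p q C 1 (n₀ := n₀) (i := i) (by omega)
    rwa [hD, hdiv, ← habs]

end CwDyn
end

section
/- Let f be a cw-hyperbolic homeomorphism of a compact metric space X and fix ε>0. For every pair of points p,q∈X and every κ∈(0, d(p,q)/2) there exists η∈(0,κ) such that: if C^s_ε(p)∩B_η(q)≠∅ and C^u_ε(p)∩B_η(q)≠∅, then there exist x∈C^s_ε(p)∩B_η(q) and y∈C^u_ε(p)∩B_η(q) with C^s_κ(x)∩C^u_κ(y)≠∅. -/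
open Metric Set Filter Topology

namespace CwDyn

variable {X : Type*} [MetricSpace X]

/-- Local product structure far from the basepoint: intersections of stable and unstable
continua of `p` near `q` produce an intersection of small local stable/unstable continua. -/
theorem exists_eta_localProduct
    [CompactSpace X]
    (f : X ≃ₜ X) (hf : CwHyperbolic f) (ε : ℝ) (hε : 0 < ε)
    (p q : X) (κ : ℝ) (hκpos : 0 < κ) (hκlt : κ < dist p q / 2) :
    ∃ η : ℝ, 0 < η ∧ η < κ ∧
      ((Cs f ε p ∩ ball q η).Nonempty → (Cu f ε p ∩ ball q η).Nonempty →
        ∃ x ∈ Cs f ε p ∩ ball q η, ∃ y ∈ Cu f ε p ∩ ball q η,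
          (Cs f κ x ∩ Cu f κ y).Nonempty) := by
  obtain ⟨δ, hδ, hprod⟩ := hf.2 κ hκpos
  have hmin : 0 < min δ κ := lt_min hδ hκpos
  refine ⟨min δ κ / 2, by linarith, by linarith [min_le_right δ κ], ?_⟩
  rintro ⟨x, hx⟩ ⟨y, hy⟩
  refine ⟨x, hx, y, hy, hprod x y ?_⟩
  have hxq : dist x q < min δ κ / 2 := hx.2
  have hyq : dist y q < min δ κ / 2 := hy.2
  linarith [dist_triangle_right x y q, min_le_left δ κ]

end CwDyn
end
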